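/- arXiv:2504.11830 — 6 statements merged into one kernel-verified Lean document; each statement's English description precedes it below -/
import Mathlib

section
/- Under the stated hypotheses, there exist a constant θ ∈ [1/2, 1), constants C, C' > 0, and an open neighbourhood V ⊆ U of x* such that for all x ∈ V both (1) ‖∇f(x)‖ ≥ C·|f(x) − f(x*)|^θ and (2) |f(x) − f(x*)| ≥ C'·d(x, Z)^{1/(1−θ)} hold. -/
open Set Metric

namespace Lojasiewicz

open Filter Topology

/-- Telescoping identity for a multilinear form evaluated on two diagonals. -/
theorem multilinear_diag_sub {E : Type*} [NormedAddCommGroup E] [NormedSpace ℝ E] {k : ℕ}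
    (p : ContinuousMultilinearMap ℝ (fun _ : Fin (k + 1) => E) ℝ) (P : E →L[ℝ] E) (e v : E) (t : ℝ)
    (hv : v - P v = t • e) :
    (p fun _ => v) - (p fun _ => P v) = t * ∑ j : Fin (k + 1),
      ((p.curryMid j e).compContinuousLinearMap
        (fun i => if i.castSucc < j then P else ContinuousLinearMap.id ℝ E)) (fun _ => v) := by
  set a : ℕ → ℝ := fun j => p (fun i => if (i : ℕ) < j then P v else v) with ha
  have h0 : (p fun _ => v) = a 0 := by simp [ha]
  have h1 : (p fun _ => P v) = a (k + 1) := by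
    simp only [ha]
    congr 1; ext i
    rw [if_pos i.isLt]
  rw [h0, h1, ← neg_sub, ← Finset.sum_range_sub, Finset.sum_range, Finset.mul_sum,
    ← Finset.sum_neg_distrib]
  refine Finset.sum_congr rfl fun j _ => ?_
  rw [neg_sub]
  set m : Fin (k + 1) → E := fun i => if (i : ℕ) < j then P v else v with hm
  have e1 : a j = p (Function.update m j v) := by
    simp only [ha]; congr 1; ext i
    by_cases hij : i = j
    · subst hij; simp
    · simp [hm, hij]
  have e2 : a (j + 1) = p (Function.update m j (P v)) := by
    simp only [ha]; congr 1; ext i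
    by_cases hij : i = j
    · subst hij; simp
    · have : (i : ℕ) ≠ j := fun h => hij (Fin.ext h)
      have : ((i : ℕ) < j + 1) ↔ ((i : ℕ) < j) := by omega
      simp [hm, hij, this]
  rw [e1, e2, ← ContinuousMultilinearMap.map_update_sub, hv,
    ContinuousMultilinearMap.map_update_smul, smul_eq_mul]
  congr 1
  simp only [ContinuousMultilinearMap.compContinuousLinearMap_apply,
    ContinuousMultilinearMap.curryMid_apply]
  congr 1
  ext i
  rcases Fin.eq_self_or_eq_succAbove j i with rfl | ⟨l, rfl⟩
  · simp
  · simp only [Function.update_of_ne (Fin.succAbove_ne j l), Fin.insertNth_apply_succAbove, hm]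
    by_cases hl : l.castSucc < j
    · have : ((j.succAbove l : Fin (k+1)) : ℕ) < j := by
        rw [Fin.succAbove_of_castSucc_lt _ _ hl]; exact hl
      simp [this, hl]
    · have : ¬ ((j.succAbove l : Fin (k+1)) : ℕ) < j := by
        rw [Fin.succAbove_of_le_castSucc _ _ (not_lt.mp hl)]
        have : (j : ℕ) ≤ l := not_lt.mp hl
        simp; omega
      simp [this, hl]

/-- **Hadamard's lemma** for real-analytic functions. -/
theorem exists_analytic_quotient {V : Type*} [NormedAddCommGroup V] [NormedSpace ℝ V]
    {g : V × ℝ → ℝ} (hg : AnalyticAt ℝ g 0) :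
    ∃ h : V × ℝ → ℝ, AnalyticAt ℝ h 0 ∧ ∀ᶠ p in 𝓝 (0 : V × ℝ), g p = g (p.1, 0) + p.2 * h p := by
  obtain ⟨p, r, hp⟩ := hg
  let P : V × ℝ →L[ℝ] V × ℝ := (ContinuousLinearMap.fst ℝ V ℝ).prod 0
  have hP : ‖P‖ ≤ 1 := by
    refine ContinuousLinearMap.opNorm_le_bound _ zero_le_one fun x => ?_
    simp [P, Prod.norm_def]
  let e : V × ℝ := (0, 1)
  have he : ‖e‖ ≤ 1 := by simp [e, Prod.norm_def]
  let q : FormalMultilinearSeries ℝ (V × ℝ) ℝ := fun k => ∑ j : Fin (k + 1),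
    ((p (k + 1)).curryMid j e).compContinuousLinearMap
      (fun i => if i.castSucc < j then P else ContinuousLinearMap.id ℝ (V × ℝ))
  have hq : ∀ k, ‖q k‖ ≤ (k + 1) * ‖p (k + 1)‖ := by
    intro k
    refine (norm_sum_le _ _).trans ?_
    have : ∀ j ∈ (Finset.univ : Finset (Fin (k + 1))),
        ‖((p (k + 1)).curryMid j e).compContinuousLinearMap
        (fun i => if i.castSucc < j then P else ContinuousLinearMap.id ℝ (V × ℝ))‖ 
        ≤ ‖p (k + 1)‖ := by
      intro j _
      refine (ContinuousMultilinearMap.norm_compContinuousLinearMap_le _ _).trans ?_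
      have h1 : ‖(p (k + 1)).curryMid j e‖ ≤ ‖p (k + 1)‖ := by
        refine (ContinuousLinearMap.le_opNorm _ _).trans ?_
        rw [ContinuousMultilinearMap.norm_curryMid]
        exact mul_le_of_le_one_right (norm_nonneg _) he
      have h2 : ∏ i : Fin k, ‖(if i.castSucc < j then P else ContinuousLinearMap.id ℝ (V × ℝ))‖
          ≤ 1 := by
        refine Finset.prod_le_one (fun _ _ => norm_nonneg _) fun i _ => ?_
        split_ifs
        · exact hP
        · exact ContinuousLinearMap.norm_id_le
      calc _ ≤ ‖(p (k + 1)).curryMid j e‖ * 1 := by gcongr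
        _ ≤ _ := by rw [mul_one]; exact h1
    refine (Finset.sum_le_sum this).trans ?_
    simp
  have hqr : 0 < q.radius := by
    obtain ⟨C, a, hC, ha, hCa⟩ := p.le_mul_pow_of_radius_pos hp.radius_pos
    let ρ : NNReal := ⟨1 / (2 * a), by positivity⟩
    have hρ : (0 : NNReal) < ρ := by
      show (0 : ℝ) < 1 / (2 * a); positivity
    refine lt_of_lt_of_le (ENNReal.coe_pos.mpr hρ) (q.le_radius_of_bound (C * a) fun n => ?_)
    have h2 : ((n : ℝ) + 1) ≤ 2 ^ n := by
      exact_mod_cast Nat.lt_two_pow_self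
    calc ‖q n‖ * (ρ : ℝ) ^ n ≤ (2 ^ n * (C * a ^ (n + 1))) * (1 / (2 * a)) ^ n := by
          have hρc : (ρ : ℝ) = 1 / (2 * a) := rfl
          rw [hρc]
          gcongr
          refine (hq n).trans ?_
          gcongr
          exact hCa _
      _ = C * a := by
          rw [one_div, inv_pow, mul_pow]
          field_simp
          ring
  refine ⟨q.sum, (q.hasFPowerSeriesOnBall hqr).analyticAt, ?_⟩
  have hb1 : ∀ᶠ y in 𝓝 (0 : V × ℝ), y ∈ Metric.eball (0 : V × ℝ) r :=
    Metric.eball_mem_nhds _ hp.r_pos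
  have hb2 : ∀ᶠ y in 𝓝 (0 : V × ℝ), P y ∈ Metric.eball (0 : V × ℝ) r := by
    have : Tendsto P (𝓝 0) (𝓝 0) := by simpa using P.continuous.tendsto 0
    exact this.eventually hb1
  have hb3 : ∀ᶠ y in 𝓝 (0 : V × ℝ), y ∈ Metric.eball (0 : V × ℝ) q.radius :=
    Metric.eball_mem_nhds _ hqr
  filter_upwards [hb1, hb2, hb3] with y h1 h2 h3
  have s1 := hp.hasSum h1
  have s2 := hp.hasSum h2
  have s3 := (q.hasFPowerSeriesOnBall hqr).hasSum h3
  rw [zero_add] at s1 s2 s3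
  have s4 := s1.sub s2
  rw [← hasSum_nat_add_iff' 1] at s4
  have hy : y - P y = y.2 • e := by
    ext <;> simp [P, e]
  have s5 : HasSum (fun k => y.2 * q k fun _ => y) (g y - g (P y)) := by
    have h0 : (p 0 fun _ => y) = p 0 fun _ => P y := by
      congr 1; funext i; exact i.elim0
    have hk : (fun k => y.2 * q k fun _ => y) =
        fun k => (p (k + 1) fun _ => y) - p (k + 1) fun _ => P y := by
      funext k
      rw [multilinear_diag_sub (p (k + 1)) P e y y.2 hy]
      simp [q]
    rw [hk]
    simpa [h0] using s4
  have := s5.unique (s3.mul_left y.2)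
  have hPy : P y = (y.1, 0) := by simp [P]
  rw [hPy] at this
  linarith

section NormalCrossings

variable {X Y W ι κ : Type*} [NormedAddCommGroup X] [NormedSpace ℝ X]
  [NormedAddCommGroup Y] [NormedSpace ℝ Y] [NormedAddCommGroup W] [NormedSpace ℝ W]
  [Fintype ι] [Fintype κ]

/-- Near the origin, `f` is a monomial in the functions `e · i` times an analytic unit. -/
def NC (e : X → ι → ℝ) (f : X → ℝ) : Prop :=
  ∃ (α : ι → ℕ) (u : X → ℝ), AnalyticAt ℝ u 0 ∧ u 0 ≠ 0 ∧
    f =ᶠ[𝓝 0] fun x => (∏ i, e x i ^ α i) * u x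

theorem NC.congr {e : X → ι → ℝ} {f g : X → ℝ} (hf : NC e f) (h : g =ᶠ[𝓝 0] f) : NC e g := by
  obtain ⟨α, u, hu, hu0, hfu⟩ := hf
  exact ⟨α, u, hu, hu0, h.trans hfu⟩

theorem NC.of_unit {e : X → ι → ℝ} {u : X → ℝ} (hu : AnalyticAt ℝ u 0) (hu0 : u 0 ≠ 0) :
    NC e u :=
  ⟨0, u, hu, hu0, by simp⟩

theorem NC.coord (e : X → ι → ℝ) (i : ι) : NC e (fun x => e x i) := by
  classical
  refine ⟨Pi.single i 1, fun _ => 1, analyticAt_const, one_ne_zero, Eventually.of_forall ?_⟩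
  intro x
  simp only [mul_one]
  rw [Finset.prod_eq_single i]
  · simp
  · intro j _ hj
    simp [hj]
  · simp

theorem NC.mul {e : X → ι → ℝ} {f g : X → ℝ} (hf : NC e f) (hg : NC e g) :
    NC e (fun x => f x * g x) := by
  obtain ⟨α, u, hu, hu0, hfu⟩ := hf
  obtain ⟨β, v, hv, hv0, hgv⟩ := hg
  refine ⟨α + β, fun x => u x * v x, hu.mul hv, mul_ne_zero hu0 hv0, ?_⟩
  filter_upwards [hfu, hgv] with x h1 h2
  rw [h1, h2]
  simp only [Pi.add_apply, pow_add, Finset.prod_mul_distrib]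
  ring

theorem NC.pow {e : X → ι → ℝ} {f : X → ℝ} (hf : NC e f) (k : ℕ) :
    NC e (fun x => f x ^ k) := by
  induction k with
  | zero => simpa using NC.of_unit (e := e) (u := fun _ => (1 : ℝ)) analyticAt_const one_ne_zero
  | succ k ih => simpa only [pow_succ] using ih.mul hf

theorem NC.prod {e : X → ι → ℝ} (s : Finset κ) {f : κ → X → ℝ} (hf : ∀ k ∈ s, NC e (f k)) :
    NC e (fun x => ∏ k ∈ s, f k x) := by
  classical
  induction s using Finset.induction_on with
  | empty => simpa using NC.of_unit (e := e) (u := fun _ => (1 : ℝ)) analyticAt_const one_ne_zero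
  | insert a s ha ih =>
    simp only [Finset.prod_insert ha]
    exact (hf a (Finset.mem_insert_self a s)).mul
      (ih fun k hk => hf k (Finset.mem_insert_of_mem hk))

theorem NC.monomial {e : X → ι → ℝ} {f : κ → X → ℝ} (hf : ∀ k, NC e (f k)) (α : κ → ℕ) :
    NC e (fun x => ∏ k, f k x ^ α k) :=
  NC.prod _ fun k _ => (hf k).pow (α k)

theorem NC.comp {e : X → ι → ℝ} {e' : Y → κ → ℝ} {f : X → ℝ} {π : Y → X} (hf : NC e f)
    (hπ : AnalyticAt ℝ π 0) (h0 : π 0 = 0) (he : ∀ i, NC e' fun y => e (π y) i) :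
    NC e' (fun y => f (π y)) := by
  obtain ⟨α, u, hu, hu0, hfu⟩ := hf
  have ht : Tendsto π (𝓝 0) (𝓝 0) := by simpa only [h0] using hπ.continuousAt.tendsto
  have hu' : AnalyticAt ℝ (fun y => u (π y)) 0 := by
    rw [← h0] at hu
    exact hu.comp hπ
  exact ((NC.monomial he α).mul (NC.of_unit hu' (by rwa [h0]))).congr (ht.eventually hfu)

/-- A local analytic modification `π`, with `σ` a section of `π` along the filter. -/
structure IsLift (𝒰 : Filter X) (π : Y → X) (σ : X → Y) : Prop where
  analyticAt : AnalyticAt ℝ π 0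
  map_zero : π 0 = 0
  tendsto : Tendsto σ 𝒰 (𝓝 0)
  section_eq : ∀ᶠ x in 𝒰, π (σ x) = x

theorem IsLift.refl {𝒰 : Filter X} (h : 𝒰 ≤ 𝓝 0) : IsLift 𝒰 (id : X → X) id :=
  ⟨analyticAt_id, rfl, h, Eventually.of_forall fun _ => rfl⟩

theorem IsLift.comp {𝒰 : Filter X} {π : Y → X} {σ : X → Y} {π' : W → Y} {σ' : Y → W}
    (h : IsLift 𝒰 π σ) (h' : IsLift (𝒰.map σ) π' σ') :
    IsLift 𝒰 (fun w => π (π' w)) (fun x => σ' (σ x)) := by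
  refine ⟨?_, by rw [h'.map_zero, h.map_zero], h'.tendsto.comp tendsto_map, ?_⟩
  · have := h.analyticAt
    rw [← h'.map_zero] at this
    exact this.comp h'.analyticAt
  · have := h'.section_eq
    rw [eventually_map] at this
    filter_upwards [h.section_eq, this] with x h1 h2
    rw [h2, h1]

theorem IsLift.tendsto_nhds {𝒰 : Filter X} {π : Y → X} {σ : X → Y} (h : IsLift 𝒰 π σ) :
    Tendsto π (𝓝 0) (𝓝 0) := by
  simpa only [h.map_zero] using h.analyticAt.continuousAt.tendsto

theorem IsLift.analyticAt_comp {𝒰 : Filter X} {π : Y → X} {σ : X → Y} (h : IsLift 𝒰 π σ)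
    {f : X → W} (hf : AnalyticAt ℝ f 0) : AnalyticAt ℝ (fun y => f (π y)) 0 := by
  rw [← h.map_zero] at hf
  exact hf.comp h.analyticAt

/-- A real function that is bounded along an ultrafilter converges along it. -/
theorem exists_tendsto_of_bounded {α : Type*} (𝒰 : Ultrafilter α) {f : α → ℝ} {C : ℝ}
    (h : ∀ᶠ x in 𝒰, |f x| ≤ C) : ∃ c, Tendsto f 𝒰 (𝓝 c) := by
  have h1 : Icc (-C) C ∈ 𝒰.map f := by
    rw [Ultrafilter.mem_map]
    filter_upwards [h] with x hx using abs_le.mp hx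
  obtain ⟨c, -, hc⟩ := isCompact_Icc.ultrafilter_le_nhds (𝒰.map f) (le_principal_iff.mpr h1)
  exact ⟨c, hc⟩

end NormalCrossings

section Charts

variable {n : ℕ}

/-- The coordinates of a point of `(Fin n → ℝ) × ℝ`, the last factor coming first. -/
def crd (p : (Fin n → ℝ) × ℝ) : Fin (n + 1) → ℝ := Fin.cons p.2 p.1

theorem NC.snd : NC (crd (n := n)) (fun p => p.2) := NC.coord crd 0

theorem NC.fst (j : Fin n) : NC (crd (n := n)) (fun p => p.1 j) := NC.coord crd j.succ

theorem analyticAt_fst_apply (j : Fin n) (p : (Fin n → ℝ) × ℝ) :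
    AnalyticAt ℝ (fun p : (Fin n → ℝ) × ℝ => p.1 j) p :=
  ((ContinuousLinearMap.proj (R := ℝ) (φ := fun _ : Fin n => ℝ) j).comp
    (ContinuousLinearMap.fst ℝ (Fin n → ℝ) ℝ)).analyticAt p

theorem analyticAt_monomial_fst (β : Fin n → ℕ) (p : (Fin n → ℝ) × ℝ) :
    AnalyticAt ℝ (fun p : (Fin n → ℝ) × ℝ => ∏ i, p.1 i ^ β i) p :=
  Finset.analyticAt_fun_prod _ fun i _ => (analyticAt_fst_apply i p).pow _

theorem prod_pow_add_single (x : Fin n → ℝ) (β : Fin n → ℕ) (j : Fin n) :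
    ∏ i, x i ^ (β + Pi.single j 1 : Fin n → ℕ) i = x j * ∏ i, x i ^ β i := by
  simp only [Pi.add_apply, pow_add, Finset.prod_mul_distrib]
  rw [mul_comm]
  congr 1
  rw [Finset.prod_eq_single j]
  · simp
  · intro i _ hi
    simp [hi]
  · simp

/-- The chart `(x, w) ↦ (x, m x * (c + w))`, lifting along an ultrafilter on which
`z / m x` tends to `c`. -/
theorem isLift_scale (𝒰 : Ultrafilter ((Fin n → ℝ) × ℝ)) (h𝒰 : (𝒰 : Filter ((Fin n → ℝ) × ℝ)) ≤ 𝓝 0)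
    {m : (Fin n → ℝ) → ℝ} (hm : AnalyticAt ℝ m 0) {c : ℝ} (h0 : m 0 * c = 0)
    (hne : ∀ᶠ p in (𝒰 : Filter ((Fin n → ℝ) × ℝ)), m p.1 = 0 → p.2 = 0)
    (hc : Tendsto (fun p : (Fin n → ℝ) × ℝ => p.2 / m p.1) 𝒰 (𝓝 c)) :
    IsLift (𝒰 : Filter ((Fin n → ℝ) × ℝ)) (fun p => (p.1, m p.1 * (c + p.2)))
      (fun p => (p.1, p.2 / m p.1 - c)) := by
  have hm' : AnalyticAt ℝ (fun p : (Fin n → ℝ) × ℝ => m p.1) 0 :=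
    AnalyticAt.comp (f := Prod.fst) (x := (0 : (Fin n → ℝ) × ℝ)) hm analyticAt_fst
  refine ⟨?_, ?_, ?_, ?_⟩
  · exact analyticAt_fst.prod (hm'.mul (analyticAt_const.add analyticAt_snd))
  · simp [h0]
  · have h1 : Tendsto (fun p : (Fin n → ℝ) × ℝ => p.1) 𝒰 (𝓝 0) :=
      (continuous_fst.tendsto (0 : (Fin n → ℝ) × ℝ)).mono_left h𝒰
    have h2 := hc.sub_const c
    rw [sub_self] at h2
    exact h1.prodMk_nhds h2
  · filter_upwards [hne] with p hp
    ext
    · rfl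
    · simp only [add_sub_cancel]
      exact mul_div_cancel_of_imp' hp

/-- If `z` dominates every multiple of a monomial in `x`, then after a lift `z` divides it. -/
theorem exists_lift_dvd_monomial (N : ℕ) : ∀ (β : Fin n → ℕ), ∑ i, β i = N →
    ∀ 𝒰 : Ultrafilter ((Fin n → ℝ) × ℝ), (𝒰 : Filter ((Fin n → ℝ) × ℝ)) ≤ 𝓝 0 →
    (∀ C : ℝ, ∀ᶠ p in (𝒰 : Filter ((Fin n → ℝ) × ℝ)), C * |∏ i, p.1 i ^ β i| < |p.2|) →
    ∃ π σ : (Fin n → ℝ) × ℝ → (Fin n → ℝ) × ℝ, IsLift (𝒰 : Filter ((Fin n → ℝ) × ℝ)) π σ ∧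
      (∀ j, NC crd fun p => (π p).1 j) ∧ NC crd (fun p => (π p).2) ∧
      ∃ q : (Fin n → ℝ) × ℝ → ℝ, AnalyticAt ℝ q 0 ∧ q 0 = 0 ∧
        ∀ᶠ p in 𝓝 0, ∏ i, (π p).1 i ^ β i = (π p).2 * q p := by
  classical
  induction N with
  | zero =>
    intro β hβ 𝒰 h𝒰 hdom
    exfalso
    have hβ0 : ∀ i, β i = 0 := by simpa using hβ
    have h1 : Tendsto (fun p : (Fin n → ℝ) × ℝ => |p.2|) 𝒰 (𝓝 0) := by
      have : Tendsto (fun p : (Fin n → ℝ) × ℝ => |p.2|) (𝓝 0) (𝓝 0) := by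
        have h := (continuous_snd.abs).tendsto (0 : (Fin n → ℝ) × ℝ)
        simpa using h
      exact this.mono_left h𝒰
    have h2 : ∀ᶠ p in (𝒰 : Filter ((Fin n → ℝ) × ℝ)), |p.2| < 1 :=
      h1.eventually (gt_mem_nhds one_pos)
    obtain ⟨p, hp1, hp2⟩ := ((hdom 1).and h2).exists
    simp only [hβ0, pow_zero, Finset.prod_const_one, abs_one, mul_one] at hp1
    linarith
  | succ N ih =>
    intro β hβ 𝒰 h𝒰 hdom
    have hz : ∀ᶠ p in (𝒰 : Filter ((Fin n → ℝ) × ℝ)), p.2 ≠ 0 := by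
      filter_upwards [hdom 0] with p hp
      simpa using hp
    obtain ⟨j, hj⟩ : ∃ j, β j ≠ 0 := by
      by_contra! h
      simp [h] at hβ
    obtain ⟨β', rfl⟩ : ∃ β' : Fin n → ℕ, β = β' + Pi.single j 1 := by
      refine ⟨β - Pi.single j 1, ?_⟩
      ext i
      by_cases hi : i = j
      · subst hi
        simp only [Pi.add_apply, Pi.sub_apply, Pi.single_eq_same]
        omega
      · simp [hi]
    have hβ' : ∑ i, β' i = N := by
      simp only [Pi.add_apply, Finset.sum_add_distrib, Finset.sum_pi_single', Finset.mem_univ,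
        if_true] at hβ
      simpa using hβ
    simp only [prod_pow_add_single] at hdom ⊢
    by_cases hC : ∃ C : ℝ, ∀ᶠ p in (𝒰 : Filter ((Fin n → ℝ) × ℝ)), |p.2| ≤ C * |p.1 j|
    · obtain ⟨C, hC⟩ := hC
      have hx : ∀ᶠ p in (𝒰 : Filter ((Fin n → ℝ) × ℝ)), p.1 j ≠ 0 := by
        filter_upwards [hC, hz] with p h1 h2 h3
        rw [h3, abs_zero, mul_zero] at h1
        exact h2 (abs_nonpos_iff.mp h1)
      obtain ⟨c, hc⟩ : ∃ c, Tendsto (fun p : (Fin n → ℝ) × ℝ => p.2 / p.1 j) 𝒰 (𝓝 c) := by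
        refine exists_tendsto_of_bounded 𝒰 (C := C) ?_
        filter_upwards [hC, hx] with p h1 h2
        rw [abs_div, div_le_iff₀ (abs_pos.mpr h2)]
        exact h1
      have hL := isLift_scale 𝒰 h𝒰 (m := fun x => x j)
        ((ContinuousLinearMap.proj (R := ℝ) (φ := fun _ : Fin n => ℝ) j).analyticAt 0)
        (by simp) (hx.mono fun p h h0 => absurd h0 h) hc
      rcases eq_or_ne c 0 with rfl | hc0
      · obtain ⟨π, σ, hL', h1, h2, q, hq, hq0, hqe⟩ := ih β' hβ'
          (𝒰.map fun p : (Fin n → ℝ) × ℝ => (p.1, p.2 / p.1 j - 0)) hL.tendsto (by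
            intro C
            show ∀ᶠ p in (𝒰 : Filter ((Fin n → ℝ) × ℝ)), _
            filter_upwards [hdom C, hx] with p h3 h4
            rw [sub_zero, abs_div, lt_div_iff₀ (abs_pos.mpr h4)]
            rw [abs_mul] at h3
            linarith)
        refine ⟨_, _, hL.comp hL', h1, ?_, q, hq, hq0, ?_⟩
        · simpa using (h1 j).mul h2
        · filter_upwards [hqe] with p hp
          simp only [zero_add]
          rw [hp]
          ring
      · refine ⟨_, _, hL, NC.fst, ?_,
          fun p => (∏ i, p.1 i ^ β' i) / (c + p.2), ?_, ?_, ?_⟩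
        · exact (NC.fst j).mul (NC.of_unit (analyticAt_const.add analyticAt_snd) (by simpa))
        · exact (analyticAt_monomial_fst β' 0).div (analyticAt_const.add analyticAt_snd)
            (by simpa)
        · obtain ⟨i, hi⟩ : ∃ i, β' i ≠ 0 := by
            by_contra! h
            simp only [h, pow_zero, Finset.prod_const_one, mul_one] at hdom
            obtain ⟨p, hp1, hp2⟩ := ((hdom C).and hC).exists
            linarith
          rw [div_eq_zero_iff]
          left
          exact Finset.prod_eq_zero (Finset.mem_univ i) (by simp [hi])
        · have : ∀ᶠ p in 𝓝 (0 : (Fin n → ℝ) × ℝ), c + p.2 ≠ 0 := by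
            have : ContinuousAt (fun p : (Fin n → ℝ) × ℝ => c + p.2) 0 := by fun_prop
            exact this.eventually_ne (by simpa)
          filter_upwards [this] with p hp
          field_simp
    · push Not at hC
      have hC' : ∀ C : ℝ, ∀ᶠ p in (𝒰 : Filter ((Fin n → ℝ) × ℝ)), C * |p.1 j| < |p.2| := by
        intro C
        exact hC C
      let π : (Fin n → ℝ) × ℝ → (Fin n → ℝ) × ℝ :=
        fun p => (Function.update p.1 j (p.1 j * p.2), p.2)
      let σ : (Fin n → ℝ) × ℝ → (Fin n → ℝ) × ℝ :=
        fun p => (Function.update p.1 j (p.1 j / p.2), p.2)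
      have hπ : AnalyticAt ℝ π 0 := by
        refine AnalyticAt.prod ?_ analyticAt_snd
        rw [analyticAt_pi_iff]
        intro i
        by_cases hi : i = j
        · subst hi
          simpa using (analyticAt_fst_apply i 0).fun_mul analyticAt_snd
        · simpa [hi] using analyticAt_fst_apply i 0
      have hπ1 : ∀ i, NC crd fun p => (π p).1 i := by
        intro i
        by_cases hi : i = j
        · subst hi
          simpa [π] using (NC.fst i).mul NC.snd
        · simpa [π, hi] using NC.fst i
      have hL : IsLift (𝒰 : Filter ((Fin n → ℝ) × ℝ)) π σ := by
        refine ⟨hπ, ?_, ?_, ?_⟩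
        · ext i
          · by_cases hi : i = j
            · subst hi; simp [π]
            · simp [π, hi]
          · simp [π]
        · have h1 : Tendsto (fun p : (Fin n → ℝ) × ℝ => p.1) 𝒰 (𝓝 0) :=
            (continuous_fst.tendsto (0 : (Fin n → ℝ) × ℝ)).mono_left h𝒰
          have h2 : Tendsto (fun p : (Fin n → ℝ) × ℝ => p.2) 𝒰 (𝓝 0) :=
            (continuous_snd.tendsto (0 : (Fin n → ℝ) × ℝ)).mono_left h𝒰
          refine Tendsto.prodMk_nhds (tendsto_pi_nhds.mpr fun i => ?_) h2
          by_cases hi : i = j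
          · subst hi
            simp only [Function.update_self, Pi.zero_apply]
            rw [Metric.tendsto_nhds]
            intro ε hε
            filter_upwards [hC' ε⁻¹, hz] with p h3 h4
            rw [Real.dist_eq, sub_zero, abs_div, div_lt_iff₀ (abs_pos.mpr h4)]
            rwa [inv_mul_lt_iff₀ hε] at h3
          · simpa [hi] using (tendsto_pi_nhds.mp h1 i)
        · filter_upwards [hz] with p hp
          ext i
          · by_cases hi : i = j
            · subst hi; simp [π, σ, hp]
            · simp [π, σ, hi]
          · simp [π, σ]
      refine ⟨π, σ, hL, hπ1, NC.snd, fun p => p.1 j * ∏ i, (π p).1 i ^ β' i, ?_, by simp, ?_⟩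
      · exact (analyticAt_fst_apply j 0).mul (hL.analyticAt_comp (analyticAt_monomial_fst β' 0))
      · refine Eventually.of_forall fun p => ?_
        have : (π p).1 j = p.1 j * p.2 := by simp [π]
        rw [this]
        simp only [π]
        ring

end Charts

section Expansion

variable {V : Type*} [NormedAddCommGroup V] [NormedSpace ℝ V]

/-- The finite Taylor expansion of `g` in the last variable with analytic remainder. -/
structure HasExpansion (b : ℕ) (c : ℕ → V → ℝ) (u g : V × ℝ → ℝ) : Prop where
  coeff : ∀ j, AnalyticAt ℝ (c j) 0
  rem : AnalyticAt ℝ u 0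
  eq : g =ᶠ[𝓝 0] fun p => ∑ j ∈ Finset.range b, c j p.1 * p.2 ^ j + p.2 ^ b * u p

theorem tendsto_zero_prodMk : Tendsto (fun t : ℝ => ((0 : V), t)) (𝓝 0) (𝓝 0) := by
  have : Continuous fun t : ℝ => ((0 : V), t) := by fun_prop
  exact this.tendsto 0

theorem analyticAt_comp_zero_prodMk {g : V × ℝ → ℝ} (hg : AnalyticAt ℝ g 0) :
    AnalyticAt ℝ (fun t : ℝ => g (0, t)) 0 :=
  AnalyticAt.comp (f := fun t : ℝ => ((0 : V), t)) hg (analyticAt_const.prod analyticAt_id)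

theorem analyticAt_comp_prodMk_zero {g : V × ℝ → ℝ} (hg : AnalyticAt ℝ g 0) :
    AnalyticAt ℝ (fun x : V => g (x, 0)) 0 :=
  AnalyticAt.comp (f := fun x : V => (x, (0 : ℝ))) hg (analyticAt_id.prod analyticAt_const)

theorem analyticAt_comp_fst {f : V → ℝ} (hf : AnalyticAt ℝ f 0) :
    AnalyticAt ℝ (fun p : V × ℝ => f p.1) 0 :=
  AnalyticAt.comp (f := Prod.fst) (x := (0 : V × ℝ)) hf analyticAt_fst

theorem exists_expansion (b : ℕ) : ∀ {g : V × ℝ → ℝ}, AnalyticAt ℝ g 0 → ∀ {q : ℝ → ℝ},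
    ContinuousAt q 0 → (∀ᶠ t in 𝓝[≠] (0 : ℝ), g (0, t) = t ^ b * q t) →
    ∃ c u, HasExpansion b c u g ∧ (∀ j < b, c j 0 = 0) ∧ u 0 = q 0 := by
  induction b with
  | zero =>
    intro g hg q hq h
    refine ⟨fun _ _ => 0, g, ⟨fun _ => analyticAt_const, hg, by simp⟩, by simp, ?_⟩
    have h1 : Tendsto (fun t : ℝ => g (0, t)) (𝓝[≠] 0) (𝓝 (g 0)) :=
      (hg.continuousAt.tendsto.comp tendsto_zero_prodMk).mono_left nhdsWithin_le_nhds
    have h2 : Tendsto q (𝓝[≠] 0) (𝓝 (q 0)) := hq.tendsto.mono_left nhdsWithin_le_nhds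
    refine tendsto_nhds_unique h1 (h2.congr' ?_)
    filter_upwards [h] with t ht
    simp [ht]
  | succ b ih =>
    intro g hg q hq h
    obtain ⟨h1, hh1, hgh⟩ := exists_analytic_quotient hg
    have hg0 : g (0, 0) = 0 := by
      have h1 : Tendsto (fun t : ℝ => g (0, t)) (𝓝[≠] 0) (𝓝 (g 0)) :=
        (hg.continuousAt.tendsto.comp tendsto_zero_prodMk).mono_left nhdsWithin_le_nhds
      have h2 : Tendsto (fun t => t ^ (b + 1) * q t) (𝓝[≠] 0) (𝓝 (0 ^ (b + 1) * q 0)) :=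
        (((continuous_pow (b + 1)).tendsto 0).mul hq.tendsto).mono_left nhdsWithin_le_nhds
      have := tendsto_nhds_unique (h1.congr' h) h2
      rwa [zero_pow b.succ_ne_zero, zero_mul] at this
    obtain ⟨c, u, hcu, hc0, hu0⟩ := ih hh1 hq (by
      have h3 := (tendsto_zero_prodMk (V := V)).eventually hgh
      filter_upwards [h, h3.filter_mono nhdsWithin_le_nhds, self_mem_nhdsWithin]
        with t ht1 ht2 ht3
      rw [ht1, hg0, zero_add] at ht2
      have ht3 : t ≠ 0 := ht3
      apply mul_left_cancel₀ ht3
      rw [← ht2]; ring)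
    refine ⟨fun j => Nat.casesOn j (fun x => g (x, 0)) c, u, ⟨?_, hcu.rem, ?_⟩, ?_, hu0⟩
    · rintro (_ | j)
      · exact analyticAt_comp_prodMk_zero hg
      · exact hcu.coeff j
    · filter_upwards [hgh, hcu.eq] with p hp1 hp2
      rw [hp1, hp2, Finset.sum_range_succ', mul_add, Finset.mul_sum]
      simp only [pow_zero, mul_one, pow_succ]
      change _ = _ + g (p.1, 0) + _
      rw [add_comm _ (g (p.1, 0)), add_assoc]
      congr 2
      · refine Finset.sum_congr rfl fun j _ => by ring
      · ring
    · rintro (_ | j) hj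
      · exact hg0
      · exact hc0 j (by omega)

/-- The derivative in the last variable. -/
noncomputable def Dz (g : V × ℝ → ℝ) (p : V × ℝ) : ℝ := fderiv ℝ g p (0, 1)

theorem analyticAt_Dz {g : V × ℝ → ℝ} {p : V × ℝ} (hg : AnalyticAt ℝ g p) :
    AnalyticAt ℝ (Dz g) p :=
  ((ContinuousLinearMap.apply ℝ ℝ ((0 : V), (1 : ℝ))).analyticAt _).comp hg.fderiv

theorem hasDerivAt_Dz {g : V × ℝ → ℝ} {p : V × ℝ} (hg : DifferentiableAt ℝ g p) :
    HasDerivAt (fun t => g (p.1, t)) (Dz g p) p.2 := by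
  have h1 : HasDerivAt (fun t : ℝ => (p.1, t)) ((0 : V), (1 : ℝ)) p.2 :=
    (hasDerivAt_const _ _).prodMk (hasDerivAt_id _)
  exact hg.hasFDerivAt.comp_hasDerivAt (f := fun t : ℝ => (p.1, t)) p.2 h1

theorem Dz_congr {g h : V × ℝ → ℝ} (H : g =ᶠ[𝓝 0] h) : Dz g =ᶠ[𝓝 0] Dz h := by
  filter_upwards [H.fderiv (𝕜 := ℝ)] with p hp
  simp [Dz, hp]

theorem analyticAt_iterate_Dz {g : V × ℝ → ℝ} (hg : AnalyticAt ℝ g 0) (k : ℕ) :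
    AnalyticAt ℝ (Dz^[k] g) 0 := by
  induction k with
  | zero => exact hg
  | succ k ih => rw [Function.iterate_succ_apply']; exact analyticAt_Dz ih

theorem HasExpansion.deriv_last {b : ℕ} {c : ℕ → V → ℝ} {u g : V × ℝ → ℝ}
    (h : HasExpansion (b + 1) c u g) :
    HasExpansion b (fun j x => (j + 1) * c (j + 1) x)
      (fun p => (b + 1) * u p + p.2 * Dz u p) (Dz g) := by
  refine ⟨fun j => analyticAt_const.mul (h.coeff _),
    (analyticAt_const.mul h.rem).add (analyticAt_snd.mul (analyticAt_Dz h.rem)), ?_⟩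
  have hg : AnalyticAt ℝ g 0 := by
    refine AnalyticAt.congr ?_ h.eq.symm
    refine AnalyticAt.add ?_ ((analyticAt_snd.pow _).mul h.rem)
    exact Finset.analyticAt_fun_sum _ fun j _ =>
      (analyticAt_comp_fst (h.coeff j)).mul (analyticAt_snd.pow _)
  filter_upwards [h.eq.eventually_nhds, h.rem.eventually_analyticAt, hg.eventually_analyticAt]
    with p hp1 hp2 hp3
  have h1 := hasDerivAt_Dz hp3.differentiableAt
  have h2 := hasDerivAt_Dz hp2.differentiableAt
  have hcont : Tendsto (fun t : ℝ => (p.1, t)) (𝓝 p.2) (𝓝 p) := by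
    have : Continuous fun t : ℝ => (p.1, t) := by fun_prop
    exact this.tendsto p.2
  have h3 : (fun t => g (p.1, t)) =ᶠ[𝓝 p.2] fun t =>
      ∑ j ∈ Finset.range (b + 1), c j p.1 * t ^ j + t ^ (b + 1) * u (p.1, t) :=
    hcont.eventually hp1
  have h4 : HasDerivAt (fun t : ℝ => ∑ j ∈ Finset.range (b + 1), c j p.1 * t ^ j)
      (∑ j ∈ Finset.range (b + 1), c j p.1 * (j * p.2 ^ (j - 1))) p.2 :=
    HasDerivAt.fun_sum fun j _ => (hasDerivAt_pow j p.2).const_mul _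
  have h5 := h4.add ((hasDerivAt_pow (b + 1) p.2).mul h2)
  rw [(h1.congr_of_eventuallyEq h3.symm).unique h5, Finset.sum_range_succ']
  simp only [Nat.cast_zero, zero_mul, mul_zero, add_zero, Nat.add_sub_cancel, Nat.cast_add,
    Nat.cast_one, Prod.mk.eta]
  congr 1
  · exact Finset.sum_congr rfl fun j _ => by ring
  · ring

theorem HasExpansion.iterate_Dz (b : ℕ) : ∀ {c : ℕ → V → ℝ} {u g : V × ℝ → ℝ},
    HasExpansion (b + 1) c u g → ∃ w : V × ℝ → ℝ, AnalyticAt ℝ w 0 ∧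
      w 0 = (b + 1).factorial * u 0 ∧
      Dz^[b] g =ᶠ[𝓝 0] fun p => b.factorial * c b p.1 + p.2 * w p := by
  induction b with
  | zero =>
    intro c u g h
    refine ⟨u, h.rem, by simp, ?_⟩
    filter_upwards [h.eq] with p hp
    simp [hp]
  | succ b ih =>
    intro c u g h
    obtain ⟨w, hw, hw0, hwe⟩ := ih h.deriv_last
    refine ⟨w, hw, ?_, ?_⟩
    · rw [hw0, Nat.factorial_succ (b + 1)]
      push_cast
      simp
      ring
    · rw [Function.iterate_succ_apply]
      filter_upwards [hwe] with p hp
      rw [hp, Nat.factorial_succ b]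
      push_cast
      ring

theorem exists_implicit [CompleteSpace V] {G : V × ℝ → ℝ} (hG : AnalyticAt ℝ G 0)
    (hG0 : G 0 = 0) (hd : Dz G 0 ≠ 0) :
    ∃ φ : V → ℝ, AnalyticAt ℝ φ 0 ∧ φ 0 = 0 ∧ ∀ᶠ x in 𝓝 0, G (x, φ x) = 0 := by
  have cdf : ContDiffAt ℝ ⊤ G 0 := hG.contDiffAt
  have hinv : (fderiv ℝ G 0 ∘L .inr ℝ V ℝ).IsInvertible := by
    refine ⟨ContinuousLinearEquiv.unitsEquivAut ℝ (Units.mk0 _ hd), ?_⟩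
    ext
    simp [Dz]
  refine ⟨cdf.implicitFunction (by simp) hinv, ?_, ?_, ?_⟩
  · exact (cdf.contDiffAt_implicitFunction (by simp) hinv).analyticAt
  · exact cdf.implicitFunction_apply_self (by simp) hinv
  · have := cdf.eventually_apply_implicitFunction (by simp) hinv
    rwa [hG0] at this

theorem Dz_comp_translate [CompleteSpace V] {g : V × ℝ → ℝ} (hg : AnalyticAt ℝ g 0) {φ : V → ℝ}
    (hφ : AnalyticAt ℝ φ 0) (hφ0 : φ 0 = 0) :
    Dz (fun p => g (p.1, p.2 + φ p.1)) =ᶠ[𝓝 0] fun p => Dz g (p.1, p.2 + φ p.1) := by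
  have hT : AnalyticAt ℝ (fun p : V × ℝ => (p.1, p.2 + φ p.1)) 0 :=
    analyticAt_fst.prod (analyticAt_snd.add (analyticAt_comp_fst hφ))
  have hT0 : Tendsto (fun p : V × ℝ => (p.1, p.2 + φ p.1)) (𝓝 0) (𝓝 0) := by
    have h := hT.continuousAt.tendsto
    simp only [Prod.fst_zero, Prod.snd_zero, hφ0, add_zero] at h
    exact h
  filter_upwards [hT0.eventually hg.eventually_analyticAt, hT.eventually_analyticAt]
    with p h1 h2
  have h3 := hasDerivAt_Dz (g := fun p => g (p.1, p.2 + φ p.1)) (p := p)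
    (h1.differentiableAt.comp p h2.differentiableAt)
  have h4 := hasDerivAt_Dz h1.differentiableAt
  exact h3.unique (h4.comp_add_const p.2 (φ p.1))

/-- **Tschirnhausen transformation**: a translation in the last variable kills the subleading
coefficient. -/
theorem exists_tschirnhausen [CompleteSpace V] {b : ℕ} {c : ℕ → V → ℝ} {u g : V × ℝ → ℝ}
    (hg : AnalyticAt ℝ g 0) (h : HasExpansion (b + 1) c u g) (hc : ∀ j < b + 1, c j 0 = 0)
    (hu : u 0 ≠ 0) :
    ∃ φ : V → ℝ, AnalyticAt ℝ φ 0 ∧ φ 0 = 0 ∧ ∀ c' u',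
      HasExpansion (b + 1) c' u' (fun p => g (p.1, p.2 + φ p.1)) → c' b =ᶠ[𝓝 0] 0 := by
  obtain ⟨w, hw, hw0, hwe⟩ := HasExpansion.iterate_Dz b h
  have hG0 : Dz^[b] g 0 = 0 := by
    rw [hwe.eq_of_nhds]
    simp [hc b (by omega)]
  have hGa := analyticAt_iterate_Dz hg b
  have hd : Dz (Dz^[b] g) 0 ≠ 0 := by
    have h1 := hasDerivAt_Dz hGa.differentiableAt
    have h2 := hasDerivAt_Dz hw.differentiableAt
    have h3 : (fun t : ℝ => Dz^[b] g ((0 : V × ℝ).1, t)) =ᶠ[𝓝 0] fun t =>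
        b.factorial * c b (0 : V) + t * w (0, t) :=
      tendsto_zero_prodMk.eventually hwe
    have h4 := (hasDerivAt_id' (0 : ℝ)).mul h2
    have h5 := h4.const_add (b.factorial * c b (0 : V))
    rw [(h1.congr_of_eventuallyEq h3.symm).unique h5]
    have : w ((0 : V × ℝ).1, 0) = w 0 := rfl
    simp only [one_mul, zero_mul, add_zero]
    show w 0 ≠ 0
    rw [hw0]
    exact mul_ne_zero (by exact_mod_cast (Nat.factorial_pos _).ne') hu
  obtain ⟨φ, hφ, hφ0, hφe⟩ := exists_implicit hGa hG0 hd
  refine ⟨φ, hφ, hφ0, fun c' u' h' => ?_⟩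
  obtain ⟨w', hw', -, hwe'⟩ := HasExpansion.iterate_Dz b h'
  have hT0 : Tendsto (fun p : V × ℝ => (p.1, p.2 + φ p.1)) (𝓝 0) (𝓝 0) := by
    have hT : AnalyticAt ℝ (fun p : V × ℝ => (p.1, p.2 + φ p.1)) 0 :=
      analyticAt_fst.prod (analyticAt_snd.add (analyticAt_comp_fst hφ))
    have h := hT.continuousAt.tendsto
    simp only [Prod.fst_zero, Prod.snd_zero, hφ0, add_zero] at h
    exact h
  have hcomm : ∀ k, Dz^[k] (fun p => g (p.1, p.2 + φ p.1)) =ᶠ[𝓝 0]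
      fun p => Dz^[k] g (p.1, p.2 + φ p.1) := by
    intro k
    induction k with
    | zero => exact EventuallyEq.rfl
    | succ k ih =>
      simp only [Function.iterate_succ_apply']
      exact (Dz_congr ih).trans (Dz_comp_translate (analyticAt_iterate_Dz hg k) hφ hφ0)
  have hS : Tendsto (fun x : V => (x, (0 : ℝ))) (𝓝 0) (𝓝 0) := by
    have : Continuous fun x : V => (x, (0 : ℝ)) := by fun_prop
    exact this.tendsto 0
  filter_upwards [hS.eventually (hcomm b), hS.eventually hwe', hφe] with x h1 h2 h3
  rw [h1] at h2
  simp only [zero_add, zero_mul, add_zero] at h2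
  rw [h3] at h2
  have := (mul_eq_zero.mp h2.symm).resolve_left (by exact_mod_cast (Nat.factorial_pos _).ne')
  exact this

end Expansion

section Principalization

variable {n : ℕ}

theorem false_of_lowest_exponent {l : Filter ℝ} [l.NeBot] (hl : l ≤ 𝓝[>] 0) {u v w : ℝ → ℝ}
    {u₀ v₀ w₀ : ℝ} (hu : Tendsto u l (𝓝 u₀)) (hv : Tendsto v l (𝓝 v₀)) (hw : Tendsto w l (𝓝 w₀))
    (hu₀ : u₀ ≠ 0) {a b c : ℕ} (hab : a < b) (hac : a < c)
    (h : ∀ᶠ t in l, t ^ a * u t + t ^ b * v t + t ^ c * w t = 0) : False := by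
  obtain ⟨b, rfl⟩ := Nat.exists_eq_add_of_lt hab
  obtain ⟨c, rfl⟩ := Nat.exists_eq_add_of_lt hac
  have hid : Tendsto (fun t : ℝ => t) l (𝓝 0) := hl.trans nhdsWithin_le_nhds
  have h1 := (hu.add ((hid.pow (b + 1)).mul hv)).add ((hid.pow (c + 1)).mul hw)
  have h2 : (fun t => u t + t ^ (b + 1) * v t + t ^ (c + 1) * w t) =ᶠ[l] fun _ => 0 := by
    filter_upwards [h, hl self_mem_nhdsWithin] with t ht ht0
    have ht0 : t ^ a ≠ 0 := pow_ne_zero _ (ne_of_gt ht0)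
    apply mul_left_cancel₀ ht0
    rw [mul_zero, ← ht]
    ring
  have h3 := tendsto_nhds_unique (h1.congr' h2) tendsto_const_nhds
  apply hu₀
  simpa using h3

/-- Evaluation of a monomial times a unit along a weighted monomial curve. -/
theorem eventually_curve {f u : (Fin n → ℝ) → ℝ} {α : Fin n → ℕ} (hu : ContinuousAt u 0)
    (hf : f =ᶠ[𝓝 0] fun x => (∏ i, x i ^ α i) * u x) (p : Fin n → ℕ) (hp : ∀ i, 0 < p i) :
    ∃ u' : ℝ → ℝ, Tendsto u' (𝓝[>] 0) (𝓝 (u 0)) ∧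
      ∀ᶠ t in 𝓝[>] (0 : ℝ), f (fun i => t ^ p i) = t ^ (∑ i, p i * α i) * u' t := by
  have hc : Tendsto (fun t : ℝ => fun i => t ^ p i) (𝓝[>] 0) (𝓝 (0 : Fin n → ℝ)) := by
    refine tendsto_pi_nhds.mpr fun i => ?_
    have : Tendsto (fun t : ℝ => t ^ p i) (𝓝 0) (𝓝 (0 ^ p i)) := (continuous_pow _).tendsto 0
    rw [zero_pow (hp i).ne'] at this
    exact this.mono_left nhdsWithin_le_nhds
  refine ⟨fun t => u fun i => t ^ p i, hu.tendsto.comp hc, ?_⟩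
  filter_upwards [hc.eventually hf] with t ht
  rw [ht]
  simp only [← pow_mul, Finset.prod_pow_eq_pow_sum]

theorem exponents_comparable {f g u v : (Fin n → ℝ) → ℝ} {α β : Fin n → ℕ}
    (hu : ContinuousAt u 0) (hu0 : u 0 ≠ 0) (hv : ContinuousAt v 0) (hv0 : v 0 ≠ 0)
    (hf : f =ᶠ[𝓝 0] fun x => (∏ i, x i ^ α i) * u x)
    (hg : g =ᶠ[𝓝 0] fun x => (∏ i, x i ^ β i) * v x)
    (hfg : (fun x => f x - g x) =ᶠ[𝓝 0] 0 ∨ NC id (fun x => f x - g x)) : α ≤ β ∨ β ≤ α := by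
  classical
  by_contra! hcon
  obtain ⟨h1, h2⟩ := hcon
  simp only [Pi.le_def, not_forall, not_le] at h1 h2
  obtain ⟨i, hi⟩ := h1
  obtain ⟨j, hj⟩ := h2
  obtain ⟨K, hK⟩ : ∃ K, K = ∑ l, α l + ∑ l, β l + 1 := ⟨_, rfl⟩
  let P : Fin n → (Fin n → ℕ) := fun i k => 1 + if k = i then K else 0
  have hP : ∀ (i) (δ : Fin n → ℕ), ∑ l, P i l * δ l = ∑ l, δ l + K * δ i := by
    intro i δ
    simp only [P, add_mul, one_mul, Finset.sum_add_distrib]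
    congr 1
    rw [Finset.sum_eq_single i] <;> simp +contextual
  have hPpos : ∀ i k, 0 < P i k := fun i k => by simp only [P]; omega
  have key1 : ∑ l, P i l * β l < ∑ l, P i l * α l := by
    rw [hP, hP]
    have := Nat.mul_le_mul_left K (Nat.succ_le_of_lt hi)
    rw [Nat.mul_succ] at this
    omega
  have key2 : ∑ l, P j l * α l < ∑ l, P j l * β l := by
    rw [hP, hP]
    have := Nat.mul_le_mul_left K (Nat.succ_le_of_lt hj)
    rw [Nat.mul_succ] at this
    omega
  obtain ⟨γ, w, hw, hw0, hfgw⟩ : ∃ (γ : Fin n → ℕ) (w : (Fin n → ℝ) → ℝ), ContinuousAt w 0 ∧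
      ((∀ p : Fin n → ℕ, (∀ i, 0 < p i) → ∑ l, p l * α l < ∑ l, p l * γ l ∧
        ∑ l, p l * β l < ∑ l, p l * γ l) ∨ w 0 ≠ 0) ∧
      (fun x => f x - g x) =ᶠ[𝓝 0] fun x => (∏ i, x i ^ γ i) * w x := by
    rcases hfg with h | ⟨γ, w, hw, hw0, h⟩
    · refine ⟨α + β + 1, 0, continuousAt_const, Or.inl fun p hp => ?_,
        h.trans (Eventually.of_forall fun x => by simp)⟩
      have : 0 < ∑ l, p l := Finset.sum_pos (fun l _ => hp l) ⟨i, Finset.mem_univ i⟩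
      simp only [Pi.add_apply, Pi.one_apply, mul_add, Finset.sum_add_distrib, mul_one]
      omega
    · exact ⟨γ, w, hw.continuousAt, Or.inr hw0, h⟩
  have main : ∀ p : Fin n → ℕ, (∀ i, 0 < p i) →
      ¬ (∑ l, p l * α l < ∑ l, p l * β l ∧ ∑ l, p l * α l < ∑ l, p l * γ l) ∧
      ¬ (∑ l, p l * β l < ∑ l, p l * α l ∧ ∑ l, p l * β l < ∑ l, p l * γ l) ∧
      (w 0 ≠ 0 → ¬ (∑ l, p l * γ l < ∑ l, p l * α l ∧ ∑ l, p l * γ l < ∑ l, p l * β l)) := by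
    intro p hp
    obtain ⟨u', hu', hue⟩ := eventually_curve hu hf p hp
    obtain ⟨v', hv', hve⟩ := eventually_curve hv hg p hp
    obtain ⟨w', hw', hwe⟩ := eventually_curve hw hfgw p hp
    refine ⟨fun h => ?_, fun h => ?_, fun hw0 h => ?_⟩
    · refine false_of_lowest_exponent le_rfl hu' hv'.neg hw'.neg hu0 h.1 h.2 ?_
      filter_upwards [hue, hve, hwe] with t h1 h2 h3
      rw [h1, h2] at h3
      linarith
    · refine false_of_lowest_exponent le_rfl hv' hu'.neg hw' hv0 h.1 h.2 ?_
      filter_upwards [hue, hve, hwe] with t h1 h2 h3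
      rw [h1, h2] at h3
      linarith
    · refine false_of_lowest_exponent le_rfl hw' hu'.neg hv' hw0 h.1 h.2 ?_
      filter_upwards [hue, hve, hwe] with t h1 h2 h3
      rw [h1, h2] at h3
      linarith
  have m1 := main (P i) (hPpos i)
  have m2 := main (P j) (hPpos j)
  have m3 := main (P i + P j) fun k => Nat.add_pos_left (hPpos i k) _
  simp only [Pi.add_apply, add_mul, Finset.sum_add_distrib] at m3
  rcases hw0 with hw0 | hw0
  · have := hw0 (P i) (hPpos i)
    omega
  · have a1 := m1.2.2 hw0
    have a2 := m2.2.2 hw0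
    have a3 := m3.2.2 hw0
    omega

/-- Local monomialization, along ultrafilters, of finite families of analytic functions. -/
def Monomializable (n : ℕ) : Prop :=
  ∀ 𝒰 : Ultrafilter (Fin n → ℝ), (𝒰 : Filter (Fin n → ℝ)) ≤ 𝓝 0 →
    ∀ S : Set ((Fin n → ℝ) → ℝ), S.Finite → (∀ g ∈ S, AnalyticAt ℝ g 0) →
      ∃ π σ : (Fin n → ℝ) → (Fin n → ℝ), IsLift (𝒰 : Filter (Fin n → ℝ)) π σ ∧
        ∀ g ∈ S, g =ᶠ[𝓝 0] 0 ∨ NC id (fun x => g (π x))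

theorem analyticAt_apply (j : Fin n) (x : Fin n → ℝ) :
    AnalyticAt ℝ (fun x : Fin n → ℝ => x j) x :=
  (ContinuousLinearMap.proj (R := ℝ) (φ := fun _ : Fin n => ℝ) j).analyticAt x

theorem not_eventually_apply_eq_zero (j : Fin n) :
    ¬ (fun x : Fin n → ℝ => x j) =ᶠ[𝓝 0] 0 := by
  intro h
  have hc : Tendsto (fun t : ℝ => fun _ : Fin n => t) (𝓝[≠] 0) (𝓝 0) := by
    have : Continuous fun t : ℝ => fun _ : Fin n => t := by fun_prop
    exact (this.tendsto 0).mono_left nhdsWithin_le_nhds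
  obtain ⟨t, h1, h2⟩ := ((hc.eventually h).and self_mem_nhdsWithin).exists
  exact h2 h1

/-- The ramified substitution `y_j = ± s_j ^ m`, with signs adapted to an ultrafilter. -/
theorem exists_lift_pow (𝒰 : Ultrafilter (Fin n → ℝ)) (h𝒰 : (𝒰 : Filter (Fin n → ℝ)) ≤ 𝓝 0)
    {m : ℕ} (hm : 0 < m) :
    ∃ (ε : Fin n → ℝ) (σ : (Fin n → ℝ) → (Fin n → ℝ)), (∀ j, ε j ≠ 0) ∧
      IsLift (𝒰 : Filter (Fin n → ℝ)) (fun s j => ε j * s j ^ m) σ := by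
  have hε : ∀ j, ∃ ε : ℝ, ε ≠ 0 ∧ ∀ᶠ y in (𝒰 : Filter (Fin n → ℝ)), ε * |y j| = y j := by
    intro j
    have hor : (∀ᶠ y in (𝒰 : Filter (Fin n → ℝ)), 0 ≤ y j) ∨
        ∀ᶠ y in (𝒰 : Filter (Fin n → ℝ)), y j ≤ 0 :=
      Ultrafilter.eventually_or.mp (Eventually.of_forall fun y => le_total _ _)
    rcases hor with h | h
    · refine ⟨1, one_ne_zero, ?_⟩
      filter_upwards [h] with y hy
      rw [abs_of_nonneg hy, one_mul]
    · refine ⟨-1, by norm_num, ?_⟩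
      filter_upwards [h] with y hy
      rw [abs_of_nonpos hy]
      ring
  choose ε hε0 hε using hε
  refine ⟨ε, fun y j => |y j| ^ ((m : ℝ)⁻¹), hε0, ?_, ?_, ?_, ?_⟩
  · rw [analyticAt_pi_iff]
    exact fun j => analyticAt_const.mul ((analyticAt_apply j 0).pow m)
  · ext j
    simp [hm.ne']
  · refine tendsto_pi_nhds.mpr fun j => ?_
    have h1 : Tendsto (fun y : Fin n → ℝ => |y j|) 𝒰 (𝓝 0) := by
      have : Continuous fun y : Fin n → ℝ => |y j| := by fun_prop
      have h := this.tendsto 0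
      simp only [Pi.zero_apply, abs_zero] at h
      exact h.mono_left h𝒰
    have h2 := h1.rpow_const (p := (m : ℝ)⁻¹) (Or.inr (by positivity))
    rwa [Real.zero_rpow (by positivity)] at h2
  · filter_upwards [eventually_all.mpr hε] with y hy
    ext j
    rw [Real.rpow_inv_natCast_pow (abs_nonneg _) hm.ne', hy j]

theorem exists_principal_lift (hM : Monomializable n) {ι : Type*} [Finite ι]
    (𝒰 : Ultrafilter (Fin n → ℝ)) (h𝒰 : (𝒰 : Filter (Fin n → ℝ)) ≤ 𝓝 0)
    (a : ι → (Fin n → ℝ) → ℝ) (ha : ∀ i, AnalyticAt ℝ (a i) 0) (k : ι → ℕ) (hk : ∀ i, 0 < k i) :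
    (∀ i, a i =ᶠ[𝓝 0] 0) ∨
    ∃ (π σ : (Fin n → ℝ) → (Fin n → ℝ)) (γ : Fin n → ℕ) (e : ι → (Fin n → ℝ) → ℝ),
      IsLift (𝒰 : Filter (Fin n → ℝ)) π σ ∧ (∀ j, NC id fun x => π x j) ∧
      (∀ i, AnalyticAt ℝ (e i) 0) ∧
      (∀ i, (fun x => a i (π x)) =ᶠ[𝓝 0] fun x => (∏ j, x j ^ γ j) ^ k i * e i x) ∧
      ∃ i, e i 0 ≠ 0 := by
  classical
  by_cases hall : ∀ i, a i =ᶠ[𝓝 0] 0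
  · exact Or.inl hall
  right
  have := Fintype.ofFinite ι
  set m : ℕ := ∏ i, k i with hmdef
  have hm : 0 < m := Finset.prod_pos fun i _ => hk i
  have hdvd : ∀ i, k i * (m / k i) = m := fun i =>
    Nat.mul_div_cancel' (Finset.dvd_prod_of_mem k (Finset.mem_univ i))
  set h : ι → (Fin n → ℝ) → ℝ := fun i x => a i x ^ (m / k i) with hh
  obtain ⟨π, σ, hL, hS⟩ := hM 𝒰 h𝒰
    (range a ∪ range (fun ij : ι × ι => fun x => h ij.1 x - h ij.2 x) ∪
      range fun (j : Fin n) (x : Fin n → ℝ) => x j)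
    (((finite_range _).union (finite_range _)).union (finite_range _)) (by
      rintro g ((⟨i, rfl⟩ | ⟨ij, rfl⟩) | ⟨j, rfl⟩)
      · exact ha i
      · exact ((ha _).pow _).sub ((ha _).pow _)
      · exact analyticAt_apply j 0)
  have hcoord : ∀ j, NC id fun x => π x j := fun j =>
    (hS _ (Or.inr ⟨j, rfl⟩)).resolve_left (not_eventually_apply_eq_zero j)
  have hdiff : ∀ i j, (fun x => h i (π x) - h j (π x)) =ᶠ[𝓝 0] 0 ∨
      NC id fun x => h i (π x) - h j (π x) := by
    intro i j
    rcases hS _ (Or.inl (Or.inr ⟨(i, j), rfl⟩)) with h1 | h1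
    · exact Or.inl (hL.tendsto_nhds.eventually h1)
    · exact Or.inr h1
  have haNC : ∀ i, a i =ᶠ[𝓝 0] 0 ∨ NC id fun x => a i (π x) := fun i =>
    hS _ (Or.inl (Or.inl ⟨i, rfl⟩))
  have hex : ∀ i, ∃ (α : Fin n → ℕ) (u : (Fin n → ℝ) → ℝ), AnalyticAt ℝ u 0 ∧
      (¬ a i =ᶠ[𝓝 0] 0 → u 0 ≠ 0 ∧
        (fun x => a i (π x)) =ᶠ[𝓝 0] fun x => (∏ j, x j ^ α j) * u x) := by
    intro i
    rcases haNC i with h1 | ⟨α, u, hu, hu0, h1⟩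
    · exact ⟨0, 0, analyticAt_const, fun h2 => absurd h1 h2⟩
    · exact ⟨α, u, hu, fun _ => ⟨hu0, h1⟩⟩
  choose α u hu hau using hex
  set β : ι → Fin n → ℕ := fun i j => (m / k i) * α i j with hβ
  have hpow : ∀ i, ¬ a i =ᶠ[𝓝 0] 0 → (fun x => h i (π x)) =ᶠ[𝓝 0]
      fun x => (∏ j, x j ^ β i j) * u i x ^ (m / k i) := by
    intro i hi
    filter_upwards [(hau i hi).2] with x hx
    simp only [hh, hβ, hx, mul_pow, ← Finset.prod_pow, ← pow_mul, mul_comm]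
  have hcomp : ∀ i j, ¬ a i =ᶠ[𝓝 0] 0 → ¬ a j =ᶠ[𝓝 0] 0 → β i ≤ β j ∨ β j ≤ β i := by
    intro i j hi hj
    exact exponents_comparable ((hu i).pow _).continuousAt (pow_ne_zero _ (hau i hi).1)
      ((hu j).pow _).continuousAt (pow_ne_zero _ (hau j hj).1) (hpow i hi) (hpow j hj)
      (hdiff i j)
  push Not at hall
  obtain ⟨i₀, hi₀, hmin⟩ := Set.exists_min_image {i | ¬ a i =ᶠ[𝓝 0] 0} (fun i => ∑ j, β i j)
    (toFinite _) hall
  have hle : ∀ i, ¬ a i =ᶠ[𝓝 0] 0 → β i₀ ≤ β i := by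
    intro i hi
    rcases hcomp i₀ i hi₀ hi with h1 | h1
    · exact h1
    · have h2 : ∑ j, β i j = ∑ j, β i₀ j :=
        le_antisymm (Finset.sum_le_sum fun j _ => h1 j) (hmin i hi)
      have h3 := (Finset.sum_eq_sum_iff_of_le fun j _ => h1 j).mp h2
      exact fun j => (h3 j (Finset.mem_univ j)).ge
  obtain ⟨ε, τ, hε, hP⟩ := exists_lift_pow (𝒰.map σ) hL.tendsto hm
  refine ⟨_, _, β i₀, fun i => if a i =ᶠ[𝓝 0] 0 then 0 else fun s =>
    (∏ j, s j ^ (k i * (β i j - β i₀ j))) * ((∏ j, ε j ^ α i j) * u i fun j => ε j * s j ^ m),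
    hL.comp hP, ?_, ?_, ?_, i₀, ?_⟩
  · intro j
    refine (hcoord j).comp hP.analyticAt hP.map_zero fun i => ?_
    exact (NC.of_unit analyticAt_const (hε i)).mul ((NC.coord id i).pow m)
  · intro i
    beta_reduce
    split_ifs with hi
    · exact analyticAt_const
    · exact (Finset.analyticAt_fun_prod _ fun j _ => (analyticAt_apply j 0).pow _).mul
        (analyticAt_const.mul (hP.analyticAt_comp (hu i)))
  · intro i
    beta_reduce
    split_ifs with hi
    · filter_upwards [(hL.comp hP).tendsto_nhds.eventually hi] with x hx
      simpa using hx
    · filter_upwards [hP.tendsto_nhds.eventually (hau i hi).2] with s hs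
      rw [hs]
      simp only [mul_pow, Finset.prod_mul_distrib, ← Finset.prod_pow, ← pow_mul, ← mul_assoc]
      rw [← Finset.prod_mul_distrib (f := fun j => s j ^ (β i₀ j * k i))]
      have : ∀ j, s j ^ (β i₀ j * k i) * s j ^ (k i * (β i j - β i₀ j)) = s j ^ (m * α i j) := by
        intro j
        rw [← pow_add]
        congr 1
        rw [mul_comm (β i₀ j), ← mul_add, Nat.add_sub_cancel' (hle i hi j)]
        simp only [hβ, ← mul_assoc, hdvd]
      simp only [this]
      ring
  · beta_reduce
    rw [if_neg hi₀]
    simp only [Nat.sub_self, mul_zero, pow_zero, Finset.prod_const_one, one_mul]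
    refine mul_ne_zero (Finset.prod_ne_zero_iff.mpr fun j _ => pow_ne_zero _ (hε j)) ?_
    have := (hau i₀ hi₀).1
    have h0 := hP.map_zero
    rwa [h0]

end Principalization

section Resolution

variable {n : ℕ} {ι : Type*}

/-- `g` is analytic at the origin, and `g (0, t)` vanishes exactly to order `b` at `t = 0`. -/
structure Regular {V : Type*} [NormedAddCommGroup V] [NormedSpace ℝ V] (b : ℕ)
    (g : V × ℝ → ℝ) : Prop where
  analyticAt : AnalyticAt ℝ g 0
  order : ∃ q : ℝ → ℝ, ContinuousAt q 0 ∧ q 0 ≠ 0 ∧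
    ∀ᶠ t in 𝓝[≠] (0 : ℝ), g (0, t) = t ^ b * q t

/-- After a lift, each `g i` and each of the first `n` coordinates becomes a monomial times a
unit. -/
def Resolvable (𝒰 : Filter ((Fin n → ℝ) × ℝ)) (g : ι → (Fin n → ℝ) × ℝ → ℝ) : Prop :=
  ∃ π σ : (Fin n → ℝ) × ℝ → (Fin n → ℝ) × ℝ, IsLift 𝒰 π σ ∧
    (∀ i, NC crd fun p => g i (π p)) ∧ ∀ j, NC crd fun p => (π p).1 j

theorem Resolvable.of_lift {𝒰 : Filter ((Fin n → ℝ) × ℝ)} {g g' : ι → (Fin n → ℝ) × ℝ → ℝ}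
    {π σ : (Fin n → ℝ) × ℝ → (Fin n → ℝ) × ℝ} (hL : IsLift 𝒰 π σ)
    (hπ : ∀ j, NC Prod.fst fun p => (π p).1 j)
    (hg : ∀ i, ∃ m : (Fin n → ℝ) × ℝ → ℝ, NC Prod.fst m ∧
      (fun p => g i (π p)) =ᶠ[𝓝 0] fun p => m p * g' i p)
    (h : Resolvable (𝒰.map σ) g') : Resolvable 𝒰 g := by
  obtain ⟨π', σ', hL', hg', h'⟩ := h
  refine ⟨_, _, hL.comp hL', fun i => ?_, fun j => (hπ j).comp hL'.analyticAt hL'.map_zero h'⟩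
  obtain ⟨m, hm, hgm⟩ := hg i
  exact ((hm.comp hL'.analyticAt hL'.map_zero h').mul (hg' i)).congr
    (hL'.tendsto_nhds.eventually hgm)

theorem IsLift.prod_fst {𝒰 : Filter ((Fin n → ℝ) × ℝ)} (h𝒰 : 𝒰 ≤ 𝓝 0)
    {π σ : (Fin n → ℝ) → (Fin n → ℝ)} (h : IsLift (𝒰.map Prod.fst) π σ) :
    IsLift 𝒰 (fun p => (π p.1, p.2)) (fun p => (σ p.1, p.2)) := by
  refine ⟨?_, by simp [h.map_zero], ?_, ?_⟩
  · refine AnalyticAt.prod ?_ analyticAt_snd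
    exact AnalyticAt.comp (f := Prod.fst) (x := (0 : (Fin n → ℝ) × ℝ)) h.analyticAt analyticAt_fst
  · have h1 : Tendsto (fun p : (Fin n → ℝ) × ℝ => σ p.1) 𝒰 (𝓝 0) := h.tendsto.comp tendsto_map
    have h2 : Tendsto (fun p : (Fin n → ℝ) × ℝ => p.2) 𝒰 (𝓝 0) :=
      (continuous_snd.tendsto (0 : (Fin n → ℝ) × ℝ)).mono_left h𝒰
    exact h1.prodMk_nhds h2
  · have := h.section_eq
    rw [eventually_map] at this
    filter_upwards [this] with p hp
    rw [hp]

open Polynomial in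
theorem exists_root_order {b : ℕ} (a : ℕ → ℝ) {v : ℝ} (hv : v ≠ 0) (c : ℝ) :
    ∃ r ≤ b, (∃ q : ℝ → ℝ, Continuous q ∧ q 0 ≠ 0 ∧ ∀ t,
      ∑ j ∈ Finset.range b, a j * (c + t) ^ j + (c + t) ^ b * v = t ^ r * q t) ∧
      (r = b → ∀ j < b, a j = v * ((-c) ^ (b - j) * b.choose j)) := by
  set P : ℝ[X] := ∑ j ∈ Finset.range b, C (a j) * X ^ j + C v * X ^ b with hP
  have hcoeff : ∀ j < b, P.coeff j = a j := by
    intro j hj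
    simp [hP, coeff_X_pow, hj.ne, hj]
  have hb : P.coeff b = v := by
    simp [hP, coeff_X_pow]
  have hP0 : P ≠ 0 := by
    intro h
    rw [h] at hb
    exact hv (by simpa using hb.symm)
  have hdeg : P.natDegree ≤ b := by
    refine natDegree_add_le_of_degree_le (natDegree_sum_le_of_forall_le _ _ fun j hj => ?_)
      (natDegree_C_mul_X_pow_le _ _)
    exact (natDegree_C_mul_X_pow_le _ _).trans (Finset.mem_range.mp hj).le
  obtain ⟨Q, hQ, hQc⟩ := exists_eq_pow_rootMultiplicity_mul_and_not_dvd P hP0 c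
  set r := P.rootMultiplicity c
  have hQ0 : Q ≠ 0 := by
    rintro rfl
    exact hQc (dvd_zero _)
  have hdegPQ : P.natDegree = r + Q.natDegree := by
    rw [hQ, natDegree_mul (pow_ne_zero _ (X_sub_C_ne_zero c)) hQ0]
    simp
  refine ⟨r, by omega, ⟨fun t => Q.eval (c + t), by fun_prop, ?_, fun t => ?_⟩, ?_⟩
  · simpa [dvd_iff_isRoot] using hQc
  · have h := congrArg (eval (c + t)) hQ
    simp only [eval_mul, eval_pow, eval_sub, eval_X, eval_C, add_sub_cancel_left] at h
    rw [← h, hP, eval_add, eval_finsetSum]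
    simp only [eval_mul, eval_C, eval_pow, eval_X]
    rw [mul_comm v]
  · intro hr j hj
    have hQd : Q.natDegree = 0 := by omega
    rw [eq_C_of_natDegree_eq_zero hQd, hr, mul_comm] at hQ
    have h1 := congrArg (fun p => coeff p b) hQ
    have h2 := congrArg (fun p => coeff p j) hQ
    simp only [coeff_C_mul, sub_eq_add_neg X, ← C_neg, coeff_X_add_C_pow, hb, hcoeff j hj] at h1 h2
    simp only [Nat.sub_self, pow_zero, Nat.choose_self, Nat.cast_one, mul_one] at h1
    rw [h2, ← h1]

theorem apply_zero_eq_zero_of_monomial_mul {e : (Fin n → ℝ) → ℝ} (he : ContinuousAt e 0)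
    (γ : Fin n → ℕ) (h : (fun x => (∏ j, x j ^ γ j) * e x) =ᶠ[𝓝 0] 0) : e 0 = 0 := by
  obtain ⟨e', he', hee⟩ := eventually_curve (f := 0) he h.symm (fun _ => 1) fun _ => one_pos
  refine tendsto_nhds_unique_of_eventuallyEq he' tendsto_const_nhds ?_
  filter_upwards [hee, self_mem_nhdsWithin] with t h1 h2
  exact (mul_eq_zero.mp h1.symm).resolve_left (pow_ne_zero _ (ne_of_gt h2))

/-- The family after the substitution `z = m x * (c + w)`, divided by the monomial `m ^ b`. -/
theorem exists_scaled_family [Fintype ι] {b : ι → ℕ} {m : (Fin n → ℝ) → ℝ}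
    (hm : AnalyticAt ℝ m 0) (hm0 : m 0 = 0)
    {e : ι → ℕ → (Fin n → ℝ) → ℝ} (he : ∀ i j, AnalyticAt ℝ (e i j) 0)
    {u G : ι → (Fin n → ℝ) × ℝ → ℝ} (hu : ∀ i, AnalyticAt ℝ (u i) 0) (hu0 : ∀ i, u i 0 ≠ 0)
    (hG : ∀ i, G i =ᶠ[𝓝 0] fun p => ∑ j ∈ Finset.range (b i),
      (m p.1 ^ (b i - j) * e i j p.1) * p.2 ^ j + p.2 ^ b i * u i p)
    {i₁ : ι} {b₁ : ℕ} (hi₁ : b i₁ = b₁ + 1) (hi₁e : e i₁ b₁ 0 = 0)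
    (hne : ∃ i, ∃ j < b i, e i j 0 ≠ 0) (c : ℝ) :
    ∃ (b' : ι → ℕ) (g' : ι → (Fin n → ℝ) × ℝ → ℝ), ∑ i, b' i < ∑ i, b i ∧
      (∀ i, Regular (b' i) (g' i)) ∧
      ∀ i, (fun p : (Fin n → ℝ) × ℝ => G i (p.1, m p.1 * (c + p.2))) =ᶠ[𝓝 0]
        fun p => m p.1 ^ b i * g' i p := by
  have hm' : AnalyticAt ℝ (fun p : (Fin n → ℝ) × ℝ => m p.1) 0 := analyticAt_comp_fst hm
  have hπ : AnalyticAt ℝ (fun p : (Fin n → ℝ) × ℝ => (p.1, m p.1 * (c + p.2))) 0 :=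
    analyticAt_fst.prod (hm'.mul (analyticAt_const.add analyticAt_snd))
  have hπ0 : (fun p : (Fin n → ℝ) × ℝ => (p.1, m p.1 * (c + p.2))) 0 = 0 := by simp [hm0]
  have hπt : Tendsto (fun p : (Fin n → ℝ) × ℝ => (p.1, m p.1 * (c + p.2))) (𝓝 0) (𝓝 0) := by
    simpa only [hπ0] using hπ.continuousAt.tendsto
  choose b' hb' hq hb'eq using fun i => exists_root_order (b := b i) (fun j => e i j 0) (hu0 i) c
  refine ⟨b', fun i p => ∑ j ∈ Finset.range (b i), e i j p.1 * (c + p.2) ^ j +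
    (c + p.2) ^ b i * u i (p.1, m p.1 * (c + p.2)), ?_, fun i => ⟨?_, ?_⟩, fun i => ?_⟩
  · refine lt_of_le_of_ne (Finset.sum_le_sum fun i _ => hb' i) fun hsum => ?_
    have hall := (Finset.sum_eq_sum_iff_of_le fun i _ => hb' i).mp hsum
    have hc : c = 0 := by
      have h := hb'eq i₁ (hall i₁ (Finset.mem_univ _)) b₁ (by omega)
      rw [hi₁e, hi₁, Nat.add_sub_cancel_left, pow_one] at h
      have h2 : (((b₁ + 1).choose b₁ : ℕ) : ℝ) ≠ 0 := by
        rw [Nat.choose_succ_self_right]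
        positivity
      rw [eq_comm, mul_eq_zero_iff_left (hu0 i₁), mul_eq_zero_iff_right h2, neg_eq_zero] at h
      exact h
    obtain ⟨i, j, hj, hij⟩ := hne
    apply hij
    rw [hb'eq i (hall i (Finset.mem_univ _)) j hj, hc, neg_zero,
      zero_pow (Nat.sub_pos_of_lt hj).ne']
    simp
  · refine AnalyticAt.add (Finset.analyticAt_fun_sum _ fun j _ => ?_) ?_
    · exact (analyticAt_comp_fst (he i j)).mul ((analyticAt_const.add analyticAt_snd).pow j)
    · refine ((analyticAt_const.add analyticAt_snd).pow _).mul ?_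
      exact AnalyticAt.fun_comp (f := fun p : (Fin n → ℝ) × ℝ => (p.1, m p.1 * (c + p.2)))
        (by
          simp only [Prod.fst_zero, hm0, zero_mul, Prod.mk_zero_zero]
          exact hu i) hπ
  · obtain ⟨q, hqc, hq0, hqe⟩ := hq i
    refine ⟨q, hqc.continuousAt, hq0, Eventually.of_forall fun t => ?_⟩
    rw [← hqe t]
    simp only [hm0, zero_mul, Prod.mk_zero_zero]
  · filter_upwards [hπt.eventually (hG i)] with p hp
    rw [hp, mul_add (m p.1 ^ b i), Finset.mul_sum]
    congr 1
    · refine Finset.sum_congr rfl fun j hj => ?_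
      have hpow : m p.1 ^ b i = m p.1 ^ (b i - j) * m p.1 ^ j := by
        rw [← pow_add, Nat.sub_add_cancel (Finset.mem_range.mp hj).le]
      rw [hpow, mul_pow]
      ring
    · rw [mul_pow]
      ring

theorem resolvable_of_regular [Fintype ι] (hM : Monomializable n) (N : ℕ) :
    ∀ b : ι → ℕ, ∑ i, b i = N → ∀ 𝒰 : Ultrafilter ((Fin n → ℝ) × ℝ),
      (𝒰 : Filter ((Fin n → ℝ) × ℝ)) ≤ 𝓝 0 → ∀ g : ι → (Fin n → ℝ) × ℝ → ℝ,
      (∀ i, Regular (b i) (g i)) → Resolvable (𝒰 : Filter ((Fin n → ℝ) × ℝ)) g := by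
  induction N using Nat.strong_induction_on with
  | _ N ih =>
  intro b hb 𝒰 h𝒰 g hg
  by_cases hall : ∀ i, b i = 0
  · refine ⟨id, id, IsLift.refl h𝒰, fun i => NC.of_unit (hg i).analyticAt ?_, NC.fst⟩
    obtain ⟨q, hq, hq0, h⟩ := (hg i).order
    obtain ⟨c, u, hexp, -, hu⟩ := exists_expansion (b i) (hg i).analyticAt hq h
    rw [id, hexp.eq.eq_of_nhds]
    simpa [hall i, hu] using hq0
  push Not at hall
  obtain ⟨i₁, hi₁⟩ := hall
  obtain ⟨b₁, hb₁⟩ := Nat.exists_eq_succ_of_ne_zero hi₁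
  obtain ⟨φ, hφ, hφ0, hφc⟩ : ∃ φ : (Fin n → ℝ) → ℝ, AnalyticAt ℝ φ 0 ∧ φ 0 = 0 ∧ ∀ c' u',
      HasExpansion (b i₁) c' u' (fun p => g i₁ (p.1, p.2 + φ p.1)) → c' b₁ =ᶠ[𝓝 0] 0 := by
    obtain ⟨q, hq, hq0, h⟩ := (hg i₁).order
    obtain ⟨c, u, hexp, hc, hu⟩ := exists_expansion (b i₁) (hg i₁).analyticAt hq h
    rw [hb₁] at hexp hc ⊢
    exact exists_tschirnhausen (hg i₁).analyticAt hexp hc (by rwa [hu])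
  have hT : IsLift (𝒰 : Filter ((Fin n → ℝ) × ℝ)) (fun p => (p.1, p.2 + φ p.1))
      (fun p => (p.1, p.2 - φ p.1)) := by
    have hφ' := analyticAt_comp_fst hφ
    refine ⟨analyticAt_fst.prod (analyticAt_snd.add hφ'), by simp [hφ0], ?_, by simp⟩
    have : ContinuousAt (fun p : (Fin n → ℝ) × ℝ => (p.1, p.2 - φ p.1)) 0 :=
      (analyticAt_fst.prod (analyticAt_snd.sub hφ')).continuousAt
    have h := this.tendsto
    simp only [Prod.fst_zero, Prod.snd_zero, hφ0, sub_zero] at h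
    exact h.mono_left h𝒰
  have hgT : ∀ i, ∃ c u, HasExpansion (b i) c u (fun p => g i (p.1, p.2 + φ p.1)) ∧
      (∀ j < b i, c j 0 = 0) ∧ u 0 ≠ 0 := by
    intro i
    obtain ⟨q, hq, hq0, h⟩ := (hg i).order
    obtain ⟨c, u, hexp, hc, hu⟩ := exists_expansion (b i)
      (g := fun p => g i (p.1, p.2 + φ p.1)) (hT.analyticAt_comp (hg i).analyticAt) hq
      (by simpa [hφ0] using h)
    exact ⟨c, u, hexp, hc, by rwa [hu]⟩
  choose c u hexp hc hu using hgT
  refine Resolvable.of_lift (g' := fun i p => g i (p.1, p.2 + φ p.1)) hT (NC.coord Prod.fst)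
    (fun i => ⟨fun _ => 1, NC.of_unit analyticAt_const one_ne_zero, by simp⟩) ?_
  set 𝒰₁ := 𝒰.map (fun p : (Fin n → ℝ) × ℝ => (p.1, p.2 - φ p.1)) with h𝒰₁
  change Resolvable (𝒰₁ : Filter ((Fin n → ℝ) × ℝ)) _
  have h𝒰₁0 : (𝒰₁ : Filter ((Fin n → ℝ) × ℝ)) ≤ 𝓝 0 := hT.tendsto
  rcases exists_principal_lift hM (ι := Σ i, Fin (b i)) (𝒰₁.map Prod.fst)
    ((continuous_fst.tendsto (0 : (Fin n → ℝ) × ℝ)).mono_left h𝒰₁0)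
    (fun ij => c ij.1 ij.2) (fun ij => (hexp ij.1).coeff _) (fun ij => b ij.1 - ij.2)
    (fun ij => Nat.sub_pos_of_lt ij.2.2) with hzero | ⟨π₀, σ₀, γ, e', hL₀, hπ₀, he', hce', hne'⟩
  · refine ⟨id, id, IsLift.refl h𝒰₁0, fun i => ?_, NC.fst⟩
    refine ((NC.snd.pow (b i)).mul (NC.of_unit (hexp i).rem (hu i))).congr ?_
    have h1 : ∀ᶠ p : (Fin n → ℝ) × ℝ in 𝓝 0, ∀ j : Fin (b i), c i j p.1 = 0 :=
      eventually_all.mpr fun j =>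
        (continuous_fst.tendsto (0 : (Fin n → ℝ) × ℝ)).eventually (hzero ⟨i, j⟩)
    filter_upwards [(hexp i).eq, h1] with p h2 h3
    simp only [id]
    rw [h2, Finset.sum_eq_zero, zero_add]
    intro j hj
    rw [h3 ⟨j, Finset.mem_range.mp hj⟩, zero_mul]
  obtain ⟨e, he, hea⟩ : ∃ e : ι → ℕ → (Fin n → ℝ) → ℝ, (∀ i, ∀ j, ∀ hj : j < b i,
      e i j = e' ⟨i, ⟨j, hj⟩⟩) ∧ ∀ i j, AnalyticAt ℝ (e i j) 0 := by
    refine ⟨fun i j => if hj : j < b i then e' ⟨i, ⟨j, hj⟩⟩ else 0,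
      fun i j hj => by simp [hj], fun i j => ?_⟩
    beta_reduce
    split_ifs with hj
    · exact he' _
    · exact analyticAt_const
  set m : (Fin n → ℝ) → ℝ := fun x => ∏ j, x j ^ γ j with hmdef
  have hm : AnalyticAt ℝ m 0 :=
    Finset.analyticAt_fun_prod _ fun j _ => (analyticAt_apply j 0).pow _
  have hce : ∀ i, ∀ j < b i,
      (fun x => c i j (π₀ x)) =ᶠ[𝓝 0] fun x => m x ^ (b i - j) * e i j x := by
    intro i j hj
    rw [he i j hj]
    exact hce' ⟨i, ⟨j, hj⟩⟩
  have hne : ∃ i, ∃ j < b i, e i j 0 ≠ 0 := by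
    obtain ⟨⟨i, j⟩, hij⟩ := hne'
    exact ⟨i, j, j.2, by rwa [he i j j.2]⟩
  have hm0 : m 0 = 0 := by
    obtain ⟨i, j, hj, hij⟩ := hne
    have h := (hce i j hj).eq_of_nhds
    rw [hL₀.map_zero, hc i j hj] at h
    by_contra h0
    exact mul_ne_zero (pow_ne_zero _ h0) hij h.symm
  have hm_nc : NC Prod.fst fun p : (Fin n → ℝ) × ℝ => m p.1 :=
    NC.monomial (NC.coord Prod.fst) γ
  have hL := IsLift.prod_fst h𝒰₁0 hL₀
  have hLnc : ∀ j, NC Prod.fst fun p : (Fin n → ℝ) × ℝ => (π₀ p.1, p.2).1 j := fun j =>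
    (hπ₀ j).comp (e' := Prod.fst) (π := fun p : (Fin n → ℝ) × ℝ => p.1) analyticAt_fst rfl
      (NC.coord Prod.fst)
  refine Resolvable.of_lift
    (g' := fun i p => g i ((π₀ p.1, p.2).1, (π₀ p.1, p.2).2 + φ (π₀ p.1, p.2).1)) hL hLnc
    (fun i => ⟨fun _ => 1, NC.of_unit analyticAt_const one_ne_zero, by simp⟩) ?_
  set 𝒰₂ := 𝒰₁.map (fun p : (Fin n → ℝ) × ℝ => (σ₀ p.1, p.2)) with h𝒰₂
  change Resolvable (𝒰₂ : Filter ((Fin n → ℝ) × ℝ)) _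
  have h𝒰₂0 : (𝒰₂ : Filter ((Fin n → ℝ) × ℝ)) ≤ 𝓝 0 := hL.tendsto
  set u' : ι → (Fin n → ℝ) × ℝ → ℝ := fun i p => u i (π₀ p.1, p.2) with hu'def
  have hu'a : ∀ i, AnalyticAt ℝ (u' i) 0 := fun i => hL.analyticAt_comp (hexp i).rem
  have hu'0 : ∀ i, u' i 0 ≠ 0 := by
    intro i
    have h := hL.map_zero
    change u i (π₀ (0 : (Fin n → ℝ) × ℝ).1, (0 : (Fin n → ℝ) × ℝ).2) ≠ 0
    rw [h]
    exact hu i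
  have hG : ∀ i, (fun p : (Fin n → ℝ) × ℝ => g i (π₀ p.1, p.2 + φ (π₀ p.1))) =ᶠ[𝓝 0]
      fun p => ∑ j ∈ Finset.range (b i), (m p.1 ^ (b i - j) * e i j p.1) * p.2 ^ j +
        p.2 ^ b i * u' i p := by
    intro i
    have h1 : ∀ᶠ p : (Fin n → ℝ) × ℝ in 𝓝 0, ∀ j ∈ Finset.range (b i),
        c i j (π₀ p.1) = m p.1 ^ (b i - j) * e i j p.1 :=
      (Finset.eventually_all _).mpr fun j hj =>
        (continuous_fst.tendsto (0 : (Fin n → ℝ) × ℝ)).eventually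
          (hce i j (Finset.mem_range.mp hj))
    filter_upwards [hL.tendsto_nhds.eventually (hexp i).eq, h1] with p h2 h3
    rw [h2]
    congr 1
    exact Finset.sum_congr rfl fun j hj => by rw [h3 j hj]
  have hb₁e : e i₁ b₁ 0 = 0 := by
    refine apply_zero_eq_zero_of_monomial_mul (hea i₁ b₁).continuousAt γ ?_
    filter_upwards [hce i₁ b₁ (by omega), hL₀.tendsto_nhds.eventually (hφc _ _ (hexp i₁))]
      with x h1 h2
    rw [h2, hb₁, Nat.succ_sub (le_refl b₁), Nat.sub_self, pow_one] at h1
    exact h1.symm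
  by_cases hC : ∃ C : ℝ, ∀ᶠ p in (𝒰₂ : Filter ((Fin n → ℝ) × ℝ)), |p.2| ≤ C * |m p.1|
  · obtain ⟨C, hC⟩ := hC
    obtain ⟨t, ht⟩ : ∃ t, Tendsto (fun p : (Fin n → ℝ) × ℝ => p.2 / m p.1) 𝒰₂ (𝓝 t) := by
      refine exists_tendsto_of_bounded 𝒰₂ (C := |C|) ?_
      filter_upwards [hC] with p h1
      rw [abs_div]
      exact div_le_of_le_mul₀ (abs_nonneg _) (abs_nonneg _)
        (h1.trans (mul_le_mul_of_nonneg_right (le_abs_self C) (abs_nonneg _)))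
    have hS := isLift_scale 𝒰₂ h𝒰₂0 hm (by simp [hm0]) (by
      filter_upwards [hC] with p h1 h2
      simpa [h2] using h1) ht
    obtain ⟨b', g', hlt, hreg, hg'⟩ := exists_scaled_family hm hm0 hea hu'a hu'0 hG hb₁ hb₁e hne t
    exact Resolvable.of_lift hS (NC.coord Prod.fst) (fun i => ⟨_, hm_nc.pow (b i), hg' i⟩)
      (ih _ (hb ▸ hlt) b' rfl (𝒰₂.map _) hS.tendsto g' hreg)
  · push Not at hC
    obtain ⟨π, σ, hD, hD1, hD2, q, hq, hq0, hqe⟩ := exists_lift_dvd_monomial _ γ rfl 𝒰₂ h𝒰₂0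
      (fun C => hC C)
    refine ⟨π, σ, hD, fun i => ?_, hD1⟩
    refine ((hD2.pow (b i)).mul (NC.of_unit (u := fun p =>
      ∑ j ∈ Finset.range (b i), q p ^ (b i - j) * e i j (π p).1 + u' i (π p)) ?_ ?_)).congr ?_
    · refine AnalyticAt.add (Finset.analyticAt_fun_sum _ fun j _ => (hq.pow _).mul ?_)
        (hD.analyticAt_comp (hu'a i))
      exact hD.analyticAt_comp (analyticAt_comp_fst (hea i j))
    · rw [Finset.sum_eq_zero, zero_add, hD.map_zero]
      · exact hu'0 i
      · intro j hj
        rw [hq0, zero_pow (Nat.sub_pos_of_lt (Finset.mem_range.mp hj)).ne', zero_mul]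
    · filter_upwards [hD.tendsto_nhds.eventually (hG i), hqe] with p h1 h2
      rw [h1, mul_add, Finset.mul_sum]
      congr 1
      refine Finset.sum_congr rfl fun j hj => ?_
      change (∏ l, (π p).1 l ^ γ l) ^ (b i - j) * _ * _ = _
      obtain ⟨k, hk⟩ := Nat.exists_eq_add_of_lt (Finset.mem_range.mp hj)
      rw [h2, hk, show j + k + 1 - j = k + 1 by omega]
      ring

end Resolution

section Monomialization

variable {E ι : Type*} [NormedAddCommGroup E] [NormedSpace ℝ E]

theorem exists_line [Finite ι] (g : ι → E → ℝ) (hg : ∀ i, AnalyticAt ℝ (g i) 0)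
    (hne : ∀ i, ¬ g i =ᶠ[𝓝 0] 0) :
    ∃ v : E, ∀ i, g i v ≠ 0 ∧ ¬ ∀ᶠ t in 𝓝 (0 : ℝ), g i (t • v) = 0 := by
  classical
  obtain ⟨r, hr, hball⟩ := Metric.eventually_nhds_iff_ball.mp
    (eventually_all.mpr fun i => (hg i).eventually_analyticAt)
  have hdense : ∀ s : Finset ι, ∃ v ∈ ball (0 : E) r, ∀ i ∈ s, g i v ≠ 0 := by
    intro s
    induction s using Finset.induction_on with
    | empty => exact ⟨0, mem_ball_self hr, by simp⟩
    | insert a s _ ih =>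
      obtain ⟨v, hv, hvs⟩ := ih
      have h1 : ∀ᶠ w in 𝓝 v, w ∈ ball (0 : E) r ∧ ∀ i ∈ s, g i w ≠ 0 :=
        (isOpen_ball.eventually_mem hv).and ((Finset.eventually_all s).mpr fun i hi =>
          (hball v hv i).continuousAt.eventually_ne (hvs i hi))
      have h2 : ∃ᶠ w in 𝓝 v, g a w ≠ 0 := by
        intro h
        have h3 : EqOn (g a) 0 (ball 0 r) :=
          AnalyticOnNhd.eqOn_zero_of_preconnected_of_eventuallyEq_zero
            (fun y hy => hball y hy a) (convex_ball 0 r).isPreconnected hv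
            (h.mono fun w hw => not_not.mp hw)
        exact hne a (h3.eventuallyEq_of_mem (ball_mem_nhds 0 hr))
      obtain ⟨w, hw, hw1, hw2⟩ := (h2.and_eventually h1).exists
      exact ⟨w, hw1, by simpa [hw] using hw2⟩
  have := Fintype.ofFinite ι
  obtain ⟨v, hv, hvn⟩ := hdense Finset.univ
  refine ⟨v, fun i => ⟨hvn i (Finset.mem_univ i), fun h => hvn i (Finset.mem_univ i) ?_⟩⟩
  have hline : AnalyticOnNhd ℝ (fun t : ℝ => g i (t • v)) (Icc 0 1) := by
    intro t ht
    refine AnalyticAt.fun_comp (f := fun t : ℝ => t • v) (hball _ ?_ i)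
      (analyticAt_id.smul analyticAt_const)
    rw [mem_ball_zero_iff] at hv ⊢
    rw [norm_smul, Real.norm_eq_abs, abs_of_nonneg ht.1]
    nlinarith [norm_nonneg v, ht.2]
  have := hline.eqOn_zero_of_preconnected_of_eventuallyEq_zero isPreconnected_Icc
    (left_mem_Icc.mpr zero_le_one) h (right_mem_Icc.mpr zero_le_one)
  simpa using this

theorem monomializable_zero : Monomializable 0 := by
  intro 𝒰 h𝒰 S _ hS
  refine ⟨id, id, IsLift.refl h𝒰, fun g hg => ?_⟩
  by_cases h0 : g 0 = 0
  · exact Or.inl (Eventually.of_forall fun x => by rw [Subsingleton.elim x 0, h0]; rfl)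
  · exact Or.inr (NC.of_unit (hS g hg) h0)

theorem monomializable_succ {n : ℕ} (hM : Monomializable n) : Monomializable (n + 1) := by
  intro 𝒰 h𝒰 S hfin hS
  let κ := {g // g ∈ S ∧ ¬ g =ᶠ[𝓝 0] 0}
  have : Finite κ := (hfin.subset fun g (hg : g ∈ S ∧ ¬ g =ᶠ[𝓝 0] 0) => hg.1).to_subtype
  have := Fintype.ofFinite κ
  obtain ⟨v, hv⟩ := exists_line (ι := Option κ)
    (fun o => o.elim (fun x : Fin (n + 1) → ℝ => x 0) fun g => g.1)
    (by
      rintro (_ | g)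
      · exact analyticAt_apply 0 0
      · exact hS g.1 g.2.1)
    (by
      rintro (_ | g)
      · exact not_eventually_apply_eq_zero 0
      · exact g.2.2)
  have hv0 : v ≠ 0 := by
    rintro rfl
    exact (hv none).1 rfl
  let D : ((Fin n → ℝ) × ℝ) ≃L[ℝ] (Fin (n + 1) → ℝ) :=
    (ContinuousLinearEquiv.prodComm ℝ (Fin n → ℝ) ℝ).trans (Fin.consEquivL ℝ fun _ => ℝ)
  have hD : ∀ p, D p = crd p := fun p => rfl
  obtain ⟨A, hA⟩ := SeparatingDual.exists_continuousLinearEquiv_apply_eq (R := ℝ)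
    (x := D (0, 1)) (y := v) (by simp) hv0
  let L := D.trans A
  have hLline : ∀ t : ℝ, L (0, t) = t • v := by
    intro t
    rw [← hA]
    change A (D (0, t)) = _
    rw [← map_smul, ← map_smul]
    simp
  have hreg : ∀ g : κ, ∃ b, Regular b fun p => g.1 (L p) := by
    intro g
    have hga : AnalyticAt ℝ (fun p => g.1 (L p)) 0 :=
      AnalyticAt.fun_comp (by simpa using hS g.1 g.2.1) (L.analyticAt 0)
    have h1 := (hv (some g)).2
    simp only [Option.elim] at h1
    obtain ⟨b, q, hq, hq0, h⟩ :=
      (analyticAt_comp_zero_prodMk hga).exists_eventuallyEq_pow_smul_nonzero_iff.mpr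
        (by simpa only [hLline] using h1)
    refine ⟨b, hga, q, hq.continuousAt, hq0, ?_⟩
    exact (h.mono fun t ht => by simpa using ht).filter_mono nhdsWithin_le_nhds
  choose b hb using hreg
  have hL : IsLift (𝒰 : Filter (Fin (n + 1) → ℝ)) L L.symm :=
    ⟨L.analyticAt 0, map_zero L, by
      have := L.symm.continuous.tendsto 0
      rw [map_zero] at this
      exact this.mono_left h𝒰, by simp⟩
  obtain ⟨π, σ, hπ, hπnc, -⟩ := resolvable_of_regular hM _ b rfl (𝒰.map L.symm) hL.tendsto _ hb
  have hDL : IsLift ((𝒰.map L.symm).map σ : Filter ((Fin n → ℝ) × ℝ)) D.symm D :=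
    ⟨D.symm.analyticAt 0, map_zero D.symm, by
      have := D.continuous.tendsto 0
      rw [map_zero] at this
      exact this.mono_left hπ.tendsto, by simp⟩
  refine ⟨_, _, hL.comp (hπ.comp hDL), fun g hg => ?_⟩
  by_cases h0 : g =ᶠ[𝓝 0] 0
  · exact Or.inl h0
  · refine Or.inr ((hπnc ⟨g, hg, h0⟩).comp hDL.analyticAt hDL.map_zero fun i => ?_)
    simp only [← hD, ContinuousLinearEquiv.apply_symm_apply]
    exact NC.coord id i

theorem monomializable (n : ℕ) : Monomializable n := by
  induction n with
  | zero => exact monomializable_zero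
  | succ n ih => exact monomializable_succ ih

end Monomialization

section GradientInequality

variable {n : ℕ}

/-- The Euler-type identity for the partial derivative of a monomial times a unit. -/
theorem mul_fderiv_single_of_eq_monomial_mul {G u : (Fin n → ℝ) → ℝ} {α : Fin n → ℕ}
    {x : Fin n → ℝ} (hu : DifferentiableAt ℝ u x)
    (hG : G =ᶠ[𝓝 x] fun y => (∏ j, y j ^ α j) * u y) (i : Fin n) :
    x i * fderiv ℝ G x (Pi.single i 1) =
      (∏ j, x j ^ α j) * (α i * u x + x i * fderiv ℝ u x (Pi.single i 1)) := by
  classical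
  have hmon : ∀ t, ∏ j, Function.update x i t j ^ α j =
      t ^ α i * ∏ j ∈ Finset.univ.erase i, x j ^ α j := by
    intro t
    rw [← Finset.mul_prod_erase _ _ (Finset.mem_univ i), Function.update_self]
    congr 1
    refine Finset.prod_congr rfl fun j hj => ?_
    rw [Function.update_of_ne (Finset.ne_of_mem_erase hj)]
  have hmonx := hmon (x i)
  rw [Function.update_eq_self] at hmonx
  have hGd : DifferentiableAt ℝ G x := by
    refine DifferentiableAt.congr_of_eventuallyEq ?_ hG
    exact DifferentiableAt.mul
      (Finset.analyticAt_fun_prod _ fun j _ => (analyticAt_apply j x).pow _).differentiableAt hu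
  have hupd := hasDerivAt_update x i (x i)
  have hcurve : ∀ {h : (Fin n → ℝ) → ℝ}, DifferentiableAt ℝ h x →
      HasDerivAt (fun t => h (Function.update x i t)) (fderiv ℝ h x (Pi.single i 1)) (x i) := by
    intro h hh
    refine HasFDerivAt.comp_hasDerivAt (x i) ?_ hupd
    rw [Function.update_eq_self]
    exact hh.hasFDerivAt
  have h1 := hcurve hGd
  have h2 := (((hasDerivAt_pow (α i) (x i)).mul_const
    (∏ j ∈ Finset.univ.erase i, x j ^ α j)).mul (hcurve hu))
  have htend : Tendsto (fun t => Function.update x i t) (𝓝 (x i)) (𝓝 x) := by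
    have := hupd.continuousAt.tendsto
    rwa [Function.update_eq_self] at this
  have h3 := h1.unique (h2.congr_of_eventuallyEq (by
    filter_upwards [htend.eventually hG] with t ht
    rw [ht, hmon]
    rfl))
  rw [h3, hmonx]
  simp only [Function.update_eq_self]
  rcases Nat.eq_zero_or_pos (α i) with h0 | h0
  · simp [h0]
    ring
  · obtain ⟨k, hk⟩ := Nat.exists_eq_succ_of_ne_zero h0.ne'
    simp only [hk, Nat.succ_eq_add_one, Nat.add_sub_cancel]
    ring

theorem NC.rpow_le_norm_fderiv {G : (Fin n → ℝ) → ℝ} (hG : NC id G) (h0 : G 0 = 0) :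
    ∃ ρ : ℝ, 0 < ρ ∧ ρ < 1 ∧ ∃ c > 0, ∀ᶠ x in 𝓝 0, c * |G x| ^ ρ ≤ ‖fderiv ℝ G x‖ := by
  classical
  obtain ⟨α, u, hu, hu0, hGu⟩ := hG
  simp only [id] at hGu
  set A := ∑ j, α j with hA
  have hA1 : 1 ≤ A := by
    by_contra! h
    have hz : ∀ j, α j = 0 := by
      have : ∑ j, α j = 0 := by omega
      simpa using this
    rw [hGu.eq_of_nhds] at h0
    simp [hz, hu0] at h0
  have hA' : (0 : ℝ) < A + 1 := by positivity
  set μ := |u 0| / 2 with hμ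
  have hu0' := abs_pos.mpr hu0
  have hμ0 : 0 < μ := by positivity
  have ev1 : ∀ᶠ x in 𝓝 0, μ < |u x| :=
    hu.continuousAt.abs.eventually (lt_mem_nhds (by linarith))
  have ev2 : ∀ᶠ x in 𝓝 0, |u x| < 4 * μ :=
    hu.continuousAt.abs.eventually (gt_mem_nhds (by linarith))
  set B := ‖fderiv ℝ u 0‖ + 1 with hB
  have hB0 : 0 < B := by positivity
  have ev3 : ∀ᶠ x in 𝓝 0, ‖fderiv ℝ u x‖ < B :=
    hu.fderiv.continuousAt.norm.eventually (gt_mem_nhds (by linarith))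
  have ev4 : ∀ᶠ x in 𝓝 (0 : Fin n → ℝ), ‖x‖ < min 1 (μ / (2 * B)) := by
    have := (continuous_norm (E := Fin n → ℝ)).tendsto 0
    rw [norm_zero] at this
    exact this.eventually (gt_mem_nhds (by positivity))
  refine ⟨1 - 1 / (A + 1), ?_, ?_, 1 / 8 * μ ^ (1 / ((A : ℝ) + 1)), by positivity, ?_⟩
  · rw [sub_pos, div_lt_one hA']
    have : (1 : ℝ) ≤ A := by exact_mod_cast hA1
    linarith
  · have : 0 < 1 / ((A : ℝ) + 1) := by positivity
    linarith
  filter_upwards [ev1, ev2, ev3, ev4, hGu, hGu.eventuallyEq_nhds, hu.eventually_analyticAt]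
    with x h1 h2 h3 h4 h5 h6 h7
  have hρ : 1 - 1 / ((A : ℝ) + 1) ≠ 0 := by
    have : (1 : ℝ) ≤ A := by exact_mod_cast hA1
    have : 1 / ((A : ℝ) + 1) < 1 := by
      rw [div_lt_one hA']
      linarith
    exact (sub_pos.mpr this).ne'
  rcases eq_or_ne (G x) 0 with hGx | hGx
  · rw [hGx, abs_zero, Real.zero_rpow hρ, mul_zero]
    positivity
  have hne : (Finset.univ.filter fun j => α j ≠ 0).Nonempty := by
    by_contra! h
    rw [Finset.filter_eq_empty_iff] at h
    have : A = 0 := Finset.sum_eq_zero fun j hj => not_not.mp (h hj)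
    omega
  obtain ⟨i, hi, hmin⟩ := Finset.exists_min_image _ (fun j => |x j|) hne
  have hαi : α i ≠ 0 := (Finset.mem_filter.mp hi).2
  have hxi1 : |x i| ≤ ‖x‖ := norm_le_pi_norm x i
  have hxi : |x i| ≤ 1 := hxi1.trans (h4.le.trans (min_le_left _ _))
  set M := ∏ j, x j ^ α j with hM
  have hM1 : |x i| ^ A ≤ |M| := by
    rw [hM, Finset.abs_prod, hA, ← Finset.prod_pow_eq_pow_sum]
    refine Finset.prod_le_prod (fun j _ => by positivity) fun j _ => ?_
    rw [abs_pow]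
    rcases eq_or_ne (α j) 0 with hj | hj
    · simp [hj]
    · exact pow_le_pow_left₀ (abs_nonneg _) (hmin j (by simp [hj])) _
  have hGM : |G x| = |M| * |u x| := by rw [h5, abs_mul]
  have hGpos : 0 < |G x| := abs_pos.mpr hGx
  have hM2 : μ * |x i| ^ (A + 1) ≤ |G x| := by
    rw [hGM, pow_succ]
    have : |x i| ^ A * |x i| ≤ |M| * 1 :=
      mul_le_mul hM1 hxi (abs_nonneg _) (abs_nonneg _)
    nlinarith [abs_nonneg M]
  have hder := mul_fderiv_single_of_eq_monomial_mul h7.differentiableAt h6 i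
  have hsingle : ‖(Pi.single i 1 : Fin n → ℝ)‖ = 1 := by rw [Pi.norm_single, norm_one]
  have hdG : |fderiv ℝ G x (Pi.single i 1)| ≤ ‖fderiv ℝ G x‖ := by
    have := (fderiv ℝ G x).le_opNorm (Pi.single i 1)
    rwa [hsingle, mul_one] at this
  have hdu : |fderiv ℝ u x (Pi.single i 1)| ≤ B := by
    have := (fderiv ℝ u x).le_opNorm (Pi.single i 1)
    rw [hsingle, mul_one] at this
    exact this.trans h3.le
  have hlow : μ / 2 ≤ |α i * u x + x i * fderiv ℝ u x (Pi.single i 1)| := by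
    have e1 : |x i * fderiv ℝ u x (Pi.single i 1)| ≤ μ / 2 := by
      rw [abs_mul]
      calc _ ≤ μ / (2 * B) * B :=
            mul_le_mul (hxi1.trans (h4.le.trans (min_le_right _ _))) hdu (abs_nonneg _)
              (by positivity)
        _ = μ / 2 := by field_simp
    have e2 : μ ≤ |α i * u x| := by
      rw [abs_mul, Nat.abs_cast]
      have : (1 : ℝ) ≤ α i := by exact_mod_cast Nat.one_le_iff_ne_zero.mpr hαi
      nlinarith
    have e3 := abs_sub_abs_le_abs_sub (α i * u x) (-(x i * fderiv ℝ u x (Pi.single i 1)))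
    rw [abs_neg, sub_neg_eq_add] at e3
    linarith
  have hmain : 1 / 8 * |G x| ≤ |x i| * ‖fderiv ℝ G x‖ := by
    have e1 : |x i| * |fderiv ℝ G x (Pi.single i 1)| =
        |M| * |α i * u x + x i * fderiv ℝ u x (Pi.single i 1)| := by
      rw [← abs_mul, hder, abs_mul, hM]
    have e2 := mul_le_mul_of_nonneg_left hdG (abs_nonneg (x i))
    have e3 := mul_le_mul_of_nonneg_left hlow (abs_nonneg M)
    have e4 : |M| * |u x| ≤ |M| * (4 * μ) := mul_le_mul_of_nonneg_left h2.le (abs_nonneg M)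
    linarith
  have hroot : μ ^ (1 / ((A : ℝ) + 1)) * |x i| ≤ |G x| ^ (1 / ((A : ℝ) + 1)) := by
    have e := Real.rpow_le_rpow (by positivity) hM2 (z := 1 / ((A : ℝ) + 1)) (by positivity)
    rwa [Real.mul_rpow hμ0.le (by positivity), one_div, ← Nat.cast_succ,
      Real.pow_rpow_inv_natCast (abs_nonneg _) (Nat.succ_ne_zero A), Nat.cast_succ, ← one_div] at e
  rw [Real.rpow_sub hGpos, Real.rpow_one, ← mul_div_assoc, div_le_iff₀ (by positivity)]
  have e1 := mul_le_mul_of_nonneg_left hmain (a := μ ^ (1 / ((A : ℝ) + 1))) (by positivity)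
  have e2 := mul_le_mul_of_nonneg_right hroot (norm_nonneg (fderiv ℝ G x))
  linarith

theorem gradient_inequality_pi {g : (Fin n → ℝ) → ℝ} (hg : AnalyticAt ℝ g 0) (hg0 : g 0 = 0) :
    ∃ θ ∈ Ico (1 / 2 : ℝ) 1, ∃ C > (0 : ℝ), ∀ᶠ y in 𝓝 0, C * |g y| ^ θ ≤ ‖fderiv ℝ g y‖ := by
  by_cases hz : g =ᶠ[𝓝 0] 0
  · refine ⟨1 / 2, by norm_num, 1, one_pos, ?_⟩
    filter_upwards [hz] with y hy
    rw [hy, Pi.zero_apply, abs_zero, Real.zero_rpow (by norm_num), mul_zero]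
    positivity
  by_contra! hcon
  have hseq : ∀ k : ℕ, ∃ y : Fin n → ℝ, ‖y‖ < 1 / ((k : ℝ) + 1) ∧ |g y| < 1 ∧
      ‖fderiv ℝ g y‖ < 1 / ((k : ℝ) + 1) * |g y| ^ (1 - 1 / ((k : ℝ) + 2)) := by
    intro k
    have hk2 : (1 : ℝ) / (k + 2) ≤ 1 / 2 :=
      one_div_le_one_div_of_le (by norm_num) (by linarith [(Nat.cast_nonneg k : (0 : ℝ) ≤ k)])
    have hk3 : (0 : ℝ) < 1 / (k + 2) := by positivity
    have h1 := hcon (1 - 1 / ((k : ℝ) + 2)) ⟨by linarith, by linarith⟩ (1 / ((k : ℝ) + 1))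
      (by positivity)
    have h2 : ∀ᶠ y in 𝓝 (0 : Fin n → ℝ), ‖y‖ < 1 / ((k : ℝ) + 1) := by
      have := (continuous_norm (E := Fin n → ℝ)).tendsto 0
      rw [norm_zero] at this
      exact this.eventually (gt_mem_nhds (by positivity))
    have h3 : ∀ᶠ y in 𝓝 (0 : Fin n → ℝ), |g y| < 1 :=
      hg.continuousAt.abs.eventually (gt_mem_nhds (by simp [hg0]))
    obtain ⟨y, hy, hy1, hy2⟩ := (h1.and_eventually (h2.and h3)).exists
    exact ⟨y, hy1, hy2, hy⟩
  choose y hy1 hy2 hy3 using hseq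
  have hy0 : Tendsto y atTop (𝓝 0) :=
    squeeze_zero_norm (fun k => (hy1 k).le) tendsto_one_div_add_atTop_nhds_zero_nat
  set 𝒩 : Ultrafilter ℕ := hyperfilter ℕ
  have h𝒩 : (𝒩 : Filter ℕ) ≤ atTop := Nat.hyperfilter_le_atTop
  obtain ⟨π, σ, hL, hS⟩ := monomializable n (𝒩.map y) (hy0.mono_left h𝒩) {g}
    (finite_singleton g) (by simpa using hg)
  have hNC := (hS g rfl).resolve_left hz
  obtain ⟨ρ, hρ0, hρ1, c, hc, hev⟩ := hNC.rpow_le_norm_fderiv (by simpa [hL.map_zero])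
  set K := ‖fderiv ℝ π 0‖ + 1 with hK
  have ev1 : ∀ᶠ x in 𝓝 0, ‖fderiv ℝ π x‖ < K :=
    hL.analyticAt.fderiv.continuousAt.norm.eventually (gt_mem_nhds (by linarith))
  have hev2 : ∀ᶠ x in 𝓝 0, c * |g (π x)| ^ ρ ≤ ‖fderiv ℝ g (π x)‖ * K := by
    filter_upwards [hev, ev1, hL.analyticAt.eventually_analyticAt,
      hL.tendsto_nhds.eventually hg.eventually_analyticAt] with x h1 h2 h3 h4
    refine h1.trans ?_
    rw [fderiv_fun_comp x h4.differentiableAt h3.differentiableAt]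
    exact (ContinuousLinearMap.opNorm_comp_le _ _).trans
      (mul_le_mul_of_nonneg_left h2.le (norm_nonneg _))
  have hev3 : ∀ᶠ k in (𝒩 : Filter ℕ), c * |g (y k)| ^ ρ ≤ ‖fderiv ℝ g (y k)‖ * K := by
    have h1 : ∀ᶠ k in (𝒩 : Filter ℕ), _ := hL.tendsto.eventually hev2
    have h2 : ∀ᶠ k in (𝒩 : Filter ℕ), π (σ (y k)) = y k := hL.section_eq
    filter_upwards [h1, h2] with k h3 h4
    rwa [h4] at h3
  have hlim : Tendsto (fun k : ℕ => 1 / ((k : ℝ) + 1)) 𝒩 (𝓝 0) :=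
    tendsto_one_div_add_atTop_nhds_zero_nat.mono_left h𝒩
  have hK0 : 0 < K := by positivity
  obtain ⟨k, h1, h2, h3⟩ := (hev3.and
    ((hlim.eventually (gt_mem_nhds (show 0 < c / K by positivity))).and
    (hlim.eventually (gt_mem_nhds (sub_pos.mpr hρ1))))).exists
  have hk2 : (1 : ℝ) / (k + 2) ≤ 1 / (k + 1) :=
    one_div_le_one_div_of_le (by positivity) (by linarith)
  have hk1 : (1 : ℝ) / (k + 1) ≤ 1 := by
    rw [div_le_one (by positivity)]
    linarith [(Nat.cast_nonneg k : (0 : ℝ) ≤ k)]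
  have hgk : 0 < |g (y k)| := by
    rw [abs_pos]
    intro h
    have h5 := hy3 k
    rw [h, abs_zero, Real.zero_rpow (by linarith), mul_zero] at h5
    exact absurd h5 (not_lt.mpr (norm_nonneg _))
  have h5 : |g (y k)| ^ (1 - 1 / ((k : ℝ) + 2)) ≤ |g (y k)| ^ ρ :=
    Real.rpow_le_rpow_of_exponent_ge hgk (hy2 k).le (by linarith)
  have h6 : 0 < |g (y k)| ^ ρ := Real.rpow_pos_of_pos hgk ρ
  rw [lt_div_iff₀ hK0] at h2
  have h7 : ‖fderiv ℝ g (y k)‖ ≤ 1 / ((k : ℝ) + 1) * |g (y k)| ^ ρ :=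
    (hy3 k).le.trans (mul_le_mul_of_nonneg_left h5 (by positivity))
  have h8 := mul_le_mul_of_nonneg_right h7 hK0.le
  nlinarith

end GradientInequality

section Distance

variable {E : Type*} [NormedAddCommGroup E] [NormedSpace ℝ E]

theorem norm_le_of_hasFDerivAt_of_sub_le {h : E → ℝ} {h' : E →L[ℝ] ℝ} {y : E} {l : ℝ}
    (hl : 0 ≤ l) (hd : HasFDerivAt h h' y)
    (hle : ∀ᶠ w in 𝓝 y, h y - h w ≤ l * ‖w - y‖) : ‖h'‖ ≤ l := by
  have key : ∀ v, -h' v ≤ l * ‖v‖ := by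
    intro v
    have h1 := hd.hasLineDerivAt v
    have h2 := (hasDerivAt_iff_tendsto_slope_zero.mp h1).mono_left
      (nhdsWithin_mono 0 fun t (ht : t ∈ Ioi (0 : ℝ)) => ne_of_gt ht)
    have hc : Tendsto (fun t : ℝ => y + t • v) (𝓝[>] 0) (𝓝 y) := by
      have : Continuous fun t : ℝ => y + t • v := by fun_prop
      have h3 := this.tendsto 0
      rw [zero_smul, add_zero] at h3
      exact h3.mono_left nhdsWithin_le_nhds
    have h4 : -(l * ‖v‖) ≤ h' v := by
      refine ge_of_tendsto h2 ?_
      filter_upwards [hc.eventually hle, self_mem_nhdsWithin] with t ht ht0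
      have ht0 : 0 < t := ht0
      rw [add_sub_cancel_left, norm_smul, Real.norm_of_nonneg ht0.le] at ht
      simp only [zero_add, zero_smul, add_zero, smul_eq_mul]
      rw [inv_mul_eq_div, le_div_iff₀ ht0]
      linarith
    linarith
  refine h'.opNorm_le_bound hl fun v => ?_
  rw [Real.norm_eq_abs, abs_le]
  have h1 := key v
  have h2 := key (-v)
  rw [map_neg, norm_neg] at h2
  constructor <;> linarith

theorem infDist_zeros_le_of_gradient_inequality [ProperSpace E] {g : E → ℝ} {a x : E}
    {R θ C : ℝ} {U : Set E} (hθ1 : θ < 1) (hC : 0 < C) (hU : ball a R ⊆ U)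
    (hd : ∀ y ∈ ball a R, DifferentiableAt ℝ g y) (hg : ∀ y ∈ ball a R, 0 ≤ g y)
    (hgrad : ∀ y ∈ ball a R, C * g y ^ θ ≤ ‖fderiv ℝ g y‖) (hx : ‖x - a‖ < R / 4)
    (hgx : g x ^ (1 - θ) < C * (1 - θ) / 2 * (R / 4)) :
    C * (1 - θ) / 2 * infDist x {y ∈ U | g y = 0} ≤ g x ^ (1 - θ) := by
  set l := C * (1 - θ) / 2 with hl
  have hθ : 0 < 1 - θ := by linarith
  have hl0 : 0 < l := by positivity
  have hR : 0 < R := by linarith [norm_nonneg (x - a)]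
  have hsub : closedBall a (R / 2) ⊆ ball a R := closedBall_subset_ball (by linarith)
  have hxm : x ∈ closedBall a (R / 2) := by
    rw [mem_closedBall, dist_eq_norm]
    linarith
  have hcont : ContinuousOn (fun y => g y ^ (1 - θ) + l * ‖y - x‖) (closedBall a (R / 2)) := by
    refine ContinuousOn.add (ContinuousOn.rpow_const (fun y hy =>
      (hd y (hsub hy)).continuousAt.continuousWithinAt) fun y _ => Or.inr hθ.le) ?_
    fun_prop
  obtain ⟨y, hy, hmin⟩ := (isCompact_closedBall a (R / 2)).exists_isMinOn ⟨x, hxm⟩ hcont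
  have hyg := hg y (hsub hy)
  have h1 : g y ^ (1 - θ) + l * ‖y - x‖ ≤ g x ^ (1 - θ) := by
    have := hmin hxm
    simpa using this
  have h2 : l * ‖y - x‖ ≤ g x ^ (1 - θ) := by
    linarith [Real.rpow_nonneg hyg (1 - θ)]
  have h3 : ‖y - x‖ < R / 4 := lt_of_mul_lt_mul_left (h2.trans_lt hgx) hl0.le
  have hyin : y ∈ ball a (R / 2) := by
    rw [mem_ball, dist_eq_norm]
    calc ‖y - a‖ ≤ ‖y - x‖ + ‖x - a‖ := norm_sub_le_norm_sub_add_norm_sub _ _ _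
      _ < R / 2 := by linarith
  rcases hyg.eq_or_lt with h0 | hpos
  · refine le_trans (mul_le_mul_of_nonneg_left ?_ hl0.le) h2
    rw [← norm_sub_rev, ← dist_eq_norm]
    exact infDist_le_dist_of_mem ⟨hU (hsub hy), h0.symm⟩
  · exfalso
    have hder := (hd y (hsub hy)).hasFDerivAt.rpow_const (p := 1 - θ) (Or.inl hpos.ne')
    have hle := norm_le_of_hasFDerivAt_of_sub_le hl0.le hder (by
      filter_upwards [isOpen_ball.mem_nhds hyin] with w hw
      have e1 : g y ^ (1 - θ) + l * ‖y - x‖ ≤ g w ^ (1 - θ) + l * ‖w - x‖ :=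
        hmin (ball_subset_closedBall hw)
      have e2 : ‖w - x‖ ≤ ‖w - y‖ + ‖y - x‖ := norm_sub_le_norm_sub_add_norm_sub _ _ _
      have e3 := mul_le_mul_of_nonneg_left e2 hl0.le
      linarith)
    rw [norm_smul, Real.norm_of_nonneg (by positivity)] at hle
    have e1 := mul_le_mul_of_nonneg_left (hgrad y (hsub hy))
      (show 0 ≤ (1 - θ) * g y ^ (1 - θ - 1) by positivity)
    have e2 : g y ^ (1 - θ - 1) * g y ^ θ = 1 := by
      rw [← Real.rpow_add hpos, show 1 - θ - 1 + θ = 0 by ring, Real.rpow_zero]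
    have e3 : (1 - θ) * g y ^ (1 - θ - 1) * (C * g y ^ θ) = 2 * l := by
      linear_combination (1 - θ) * C * e2
    linarith

theorem eventually_gradient_inequality {n : ℕ} [FiniteDimensional ℝ E]
    (L : (Fin n → ℝ) ≃L[ℝ] E) {f : E → ℝ} {a : E} (hf : AnalyticAt ℝ f a) :
    ∃ θ ∈ Ico (1 / 2 : ℝ) 1, ∃ C > (0 : ℝ),
      ∀ᶠ x in 𝓝 a, C * |f x - f a| ^ θ ≤ ‖fderiv ℝ f x‖ := by
  have hL : AnalyticAt ℝ (fun y => a + L y) 0 :=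
    analyticAt_const.add ((L : (Fin n → ℝ) →L[ℝ] E).analyticAt 0)
  have hg : AnalyticAt ℝ (fun y => f (a + L y) - f a) 0 := by
    refine AnalyticAt.sub (AnalyticAt.fun_comp ?_ hL) analyticAt_const
    simpa using hf
  obtain ⟨θ, hθ, C, hC, hev⟩ := gradient_inequality_pi hg (by simp)
  set M := ‖(L : (Fin n → ℝ) →L[ℝ] E)‖ + 1 with hM
  have hM0 : 0 < M := by positivity
  refine ⟨θ, hθ, C / M, by positivity, ?_⟩
  have ht : Tendsto (fun x => L.symm (x - a)) (𝓝 a) (𝓝 0) := by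
    have : Continuous fun x => L.symm (x - a) := by fun_prop
    have h := this.tendsto a
    simpa using h
  filter_upwards [ht.eventually hev, hf.eventually_analyticAt] with x hx hfx
  have hxx : a + L (L.symm (x - a)) = x := by simp
  have hd : HasFDerivAt (fun y => f (a + L y) - f a)
      ((fderiv ℝ f x).comp (L : (Fin n → ℝ) →L[ℝ] E)) (L.symm (x - a)) := by
    refine HasFDerivAt.sub_const _ (HasFDerivAt.comp _ ?_ (L.hasFDerivAt.const_add a))
    rw [hxx]
    exact hfx.differentiableAt.hasFDerivAt
  rw [hd.fderiv, hxx] at hx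
  rw [div_mul_eq_mul_div, div_le_iff₀ hM0]
  refine hx.trans ((ContinuousLinearMap.opNorm_comp_le _ _).trans
    (mul_le_mul_of_nonneg_left ?_ (norm_nonneg _)))
  linarith

end Distance

end Lojasiewicz

/-- **Łojasiewicz inequalities.** Let `U ⊆ ℝ^d` be open, `f : U → ℝ` real-analytic,
and `x*` a critical point of `f` which is a minimum of `f` on `U`, such that every
critical point of `f` in `U` attains the value `f x*`. Then there exist
`θ ∈ [1/2, 1)`, constants `C, C' > 0` and an open neighbourhood `V ⊆ U` of `x*`
such that for all `x ∈ V`: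
`‖∇f(x)‖ ≥ C·|f(x) − f(x*)|^θ` and `|f(x) − f(x*)| ≥ C'·d(x, Z)^{1/(1−θ)}`,
where `Z = {x ∈ U : f(x) = f(x*)}`. -/
theorem lojasiewicz_inequalities {d : ℕ}
    (U : Set (EuclideanSpace ℝ (Fin d))) (hU : IsOpen U)
    (f : EuclideanSpace ℝ (Fin d) → ℝ) (hf : AnalyticOnNhd ℝ f U)
    (xstar : EuclideanSpace ℝ (Fin d)) (hxstar : xstar ∈ U)
    (hcrit : gradient f xstar = 0)
    (hmin : ∀ x ∈ U, f xstar ≤ f x)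
    (hflat : ∀ x ∈ U, gradient f x = 0 → f x = f xstar) :
    ∃ θ ∈ Set.Ico (1 / 2 : ℝ) 1, ∃ C > (0 : ℝ), ∃ C' > (0 : ℝ),
      ∃ V : Set (EuclideanSpace ℝ (Fin d)), IsOpen V ∧ xstar ∈ V ∧ V ⊆ U ∧
        ∀ x ∈ V,
          C * |f x - f xstar| ^ θ ≤ ‖gradient f x‖ ∧
          C' * (infDist x {y ∈ U | f y = f xstar}) ^ (1 / (1 - θ)) ≤
            |f x - f xstar| := by
  obtain ⟨θ, hθ, C, hC, hev⟩ := Lojasiewicz.eventually_gradient_inequality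
    (EuclideanSpace.equiv (Fin d) ℝ).symm (hf xstar hxstar)
  obtain ⟨hθ1, hθ2⟩ := hθ
  have hθ' : 0 < 1 - θ := by linarith
  obtain ⟨R, hR, hball⟩ := Metric.eventually_nhds_iff_ball.mp (hev.and (hU.mem_nhds hxstar))
  have hl : 0 < C * (1 - θ) / 2 := by positivity
  have hcont : ∀ᶠ x in nhds xstar,
      (f x - f xstar) ^ (1 - θ) < C * (1 - θ) / 2 * (R / 4) := by
    have h : ContinuousAt (fun x => (f x - f xstar) ^ (1 - θ)) xstar :=
      ((hf xstar hxstar).continuousAt.sub continuousAt_const).rpow_const (Or.inr hθ'.le)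
    refine h.eventually (gt_mem_nhds ?_)
    beta_reduce
    rw [sub_self, Real.zero_rpow hθ'.ne']
    positivity
  obtain ⟨r, hr, hsmall⟩ := Metric.eventually_nhds_iff_ball.mp hcont
  have hsub : ball xstar (min r (R / 4)) ⊆ ball xstar R :=
    ball_subset_ball ((min_le_right _ _).trans (by linarith))
  refine ⟨θ, ⟨hθ1, hθ2⟩, C, hC, (C * (1 - θ) / 2) ^ (1 / (1 - θ)), by positivity,
    ball xstar (min r (R / 4)), isOpen_ball, mem_ball_self (by positivity),
    fun x hx => (hball x (hsub hx)).2, fun x hx => ⟨?_, ?_⟩⟩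
  · rw [gradient, LinearIsometryEquiv.norm_map]
    exact (hball x (hsub hx)).1
  · have hx0 : 0 ≤ f x - f xstar := sub_nonneg.mpr (hmin x (hball x (hsub hx)).2)
    have hdist := Lojasiewicz.infDist_zeros_le_of_gradient_inequality
      (g := fun y => f y - f xstar) (a := xstar) (x := x) (U := U) hθ2 hC
      (fun y hy => (hball y hy).2)
      (fun y hy => ((hf y (hball y hy).2).differentiableAt).sub_const _)
      (fun y hy => sub_nonneg.mpr (hmin y (hball y hy).2))
      (fun y hy => by
        rw [fderiv_sub_const, ← abs_of_nonneg (sub_nonneg.mpr (hmin y (hball y hy).2))]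
        exact (hball y hy).1)
      (by
        rw [← dist_eq_norm]
        exact (mem_ball.mp hx).trans_le (min_le_right _ _))
      (hsmall x (ball_subset_ball (min_le_left _ _) hx))
    simp only [sub_eq_zero] at hdist
    have h := Real.rpow_le_rpow (mul_nonneg hl.le infDist_nonneg) hdist
      (z := 1 / (1 - θ)) (by positivity)
    rwa [Real.mul_rpow hl.le infDist_nonneg, ← Real.rpow_mul hx0,
      mul_one_div_cancel hθ'.ne', Real.rpow_one, ← abs_of_nonneg hx0] at h
end

section
/- If θ = 1/2, then there exist constants A, a > 0 such that d(x(t), Z) ≤ A·e^{−a·t} for all t ≥ 0. -/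
open Set Metric

/-- **Grönwall decay**: if `g' ≤ -k g` on `[0, ∞)`, then `g t ≤ g 0 * exp (-k t)` there. -/
theorem le_mul_exp_of_hasDerivAt_le {g g' : ℝ → ℝ} {k : ℝ}
    (hg : ∀ t ≥ (0 : ℝ), HasDerivAt g (g' t) t) (hg' : ∀ t ≥ (0 : ℝ), g' t ≤ -k * g t)
    {t : ℝ} (ht : 0 ≤ t) : g t ≤ g 0 * Real.exp (-k * t) := by
  have hderiv : ∀ s ≥ (0 : ℝ), HasDerivAt (fun s => g s * Real.exp (k * s))
      (g' s * Real.exp (k * s) + g s * (Real.exp (k * s) * (k * 1))) s := fun s hs =>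
    (hg s hs).mul ((hasDerivAt_id s).const_mul k).exp
  have hanti : AntitoneOn (fun s => g s * Real.exp (k * s)) (Ici 0) := by
    refine antitoneOn_of_deriv_nonpos (convex_Ici 0)
      (fun s hs => (hderiv s hs).continuousAt.continuousWithinAt) ?_ ?_
    · intro s hs
      exact (hderiv s (interior_subset hs)).differentiableAt.differentiableWithinAt
    · intro s hs
      have hs' : 0 ≤ s := interior_subset hs
      rw [(hderiv s hs').deriv]
      nlinarith [hg' s hs', Real.exp_pos (k * s)]
  have hle : g t * Real.exp (k * t) ≤ g 0 := by
    simpa using hanti (mem_Ici.2 le_rfl) (mem_Ici.2 ht) ht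
  calc g t = g t * Real.exp (k * t) * Real.exp (-k * t) := by
        rw [mul_assoc, ← Real.exp_add]; simp
    _ ≤ g 0 * Real.exp (-k * t) := by gcongr

/-- Along a gradient flow, `f` decreases at rate `‖∇f‖²`. -/
theorem HasDerivAt.comp_gradient_flow {E : Type*} [NormedAddCommGroup E]
    [InnerProductSpace ℝ E] [CompleteSpace E] {f : E → ℝ} {x : ℝ → E} {t : ℝ}
    (hf : DifferentiableAt ℝ f (x t)) (hx : HasDerivAt x (-(gradient f (x t))) t) :
    HasDerivAt (fun s => f (x s)) (-‖gradient f (x t)‖ ^ 2) t := by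
  have h := hf.hasGradientAt.hasFDerivAt.comp_hasDerivAt t hx
  rwa [InnerProductSpace.toDual_apply_apply, inner_neg_right, real_inner_self_eq_norm_sq] at h

/-- If the Łojasiewicz inequalities hold with exponent `θ = 1/2` on a neighbourhood `V`
of `x*`, then a gradient flow of `f` remaining in `V` converges to
`Z = {x ∈ U : f(x) = f(x*)}` at an exponential rate:
`d(x(t), Z) ≤ A·e^{−a·t}` for all `t ≥ 0`, for some constants `A, a > 0`. -/
theorem gradient_flow_exponential_convergence {d : ℕ}
    (U : Set (EuclideanSpace ℝ (Fin d))) (hU : IsOpen U)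
    (f : EuclideanSpace ℝ (Fin d) → ℝ) (hf : ContDiffOn ℝ 1 f U)
    (xstar : EuclideanSpace ℝ (Fin d)) (hxstar : xstar ∈ U)
    (hmin : ∀ x ∈ U, f xstar ≤ f x)
    (θ C C' : ℝ) (hθ : θ ∈ Set.Ico (1 / 2 : ℝ) 1) (hC : 0 < C) (hC' : 0 < C')
    (V : Set (EuclideanSpace ℝ (Fin d))) (hV : IsOpen V) (hxV : xstar ∈ V) (hVU : V ⊆ U)
    (hloj₁ : ∀ x ∈ V, C * |f x - f xstar| ^ θ ≤ ‖gradient f x‖)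
    (hloj₂ : ∀ x ∈ V,
      C' * (infDist x {y ∈ U | f y = f xstar}) ^ (1 / (1 - θ)) ≤ |f x - f xstar|)
    (x : ℝ → EuclideanSpace ℝ (Fin d))
    (hflow : ∀ t ≥ (0 : ℝ), HasDerivAt x (-(gradient f (x t))) t)
    (hxinV : ∀ t ≥ (0 : ℝ), x t ∈ V)
    (hθhalf : θ = 1 / 2) :
    ∃ A > (0 : ℝ), ∃ a > (0 : ℝ), ∀ t ≥ (0 : ℝ),
      infDist (x t) {y ∈ U | f y = f xstar} ≤ A * Real.exp (-a * t) := by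
  subst hθhalf
  set Z := {y ∈ U | f y = f xstar}
  have hnonneg : ∀ t ≥ (0 : ℝ), 0 ≤ f (x t) - f xstar := fun t ht =>
    sub_nonneg.2 (hmin _ (hVU (hxinV t ht)))
  have hderiv : ∀ t ≥ (0 : ℝ), HasDerivAt (fun s => f (x s) - f xstar)
      (-‖gradient f (x t)‖ ^ 2) t := fun t ht =>
    (HasDerivAt.comp_gradient_flow ((hf.differentiableOn one_ne_zero).differentiableAt
      (hU.mem_nhds (hVU (hxinV t ht)))) (hflow t ht)).sub_const _
  have hdecay : ∀ t ≥ (0 : ℝ),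
      f (x t) - f xstar ≤ (f (x 0) - f xstar) * Real.exp (-C ^ 2 * t) := by
    intro t ht
    refine le_mul_exp_of_hasDerivAt_le hderiv (fun s hs => ?_) ht
    have h := hloj₁ (x s) (hxinV s hs)
    rw [abs_of_nonneg (hnonneg s hs), ← Real.sqrt_eq_rpow] at h
    have hsq := pow_le_pow_left₀ (by positivity) h 2
    rw [mul_pow, Real.sq_sqrt (hnonneg s hs)] at hsq
    linarith
  refine ⟨√((f (x 0) - f xstar) / C') + 1, by positivity, C ^ 2 / 2, by positivity,
    fun t ht => ?_⟩
  have hdist := hloj₂ (x t) (hxinV t ht)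
  rw [abs_of_nonneg (hnonneg t ht), show (1 : ℝ) / (1 - 1 / 2) = (2 : ℕ) by norm_num,
    Real.rpow_natCast] at hdist
  have hexp : Real.exp (-C ^ 2 * t) = Real.exp (-(C ^ 2 / 2) * t) ^ 2 := by
    rw [← Real.exp_nat_mul]
    congr 1
    push_cast
    ring
  calc infDist (x t) Z ≤ √((f (x 0) - f xstar) / C') * Real.exp (-(C ^ 2 / 2) * t) := by
        refine (abs_le_of_sq_le_sq' ?_ (by positivity)).2
        rw [mul_pow, Real.sq_sqrt (div_nonneg (hnonneg 0 le_rfl) hC'.le), ← hexp,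
          div_mul_eq_mul_div, le_div_iff₀' hC']
        exact hdist.trans (hdecay t ht)
    _ ≤ _ := by gcongr; linarith
end

section
/- If θ > 1/2, then setting α = (1−θ)/(2θ−1) > 0, there exist constants A > 0 and B ∈ ℝ with t + B > 0 for all t ≥ 0, such that d(x(t), Z) ≤ A·(t + B)^{−α} for all t ≥ 0. -/
open Set Metric

/-- A nonnegative solution of `g' ≤ -c g ^ (p + 1)` on `[0, ∞)` decays like `t ^ (-1 / p)`. -/
theorem exists_le_rpow_of_deriv_le_neg_rpow {g g' : ℝ → ℝ} {p c : ℝ} (hp : 0 < p) (hc : 0 < c)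
    (hg : ∀ t ≥ (0 : ℝ), HasDerivAt g (g' t) t) (hg0 : ∀ t ≥ (0 : ℝ), 0 ≤ g t)
    (hg' : ∀ t ≥ (0 : ℝ), g' t ≤ -(c * g t ^ (p + 1))) :
    ∃ B > (0 : ℝ), ∀ t ≥ (0 : ℝ), g t ≤ (p * c * (t + B)) ^ (-(1 / p)) := by
  have hanti : AntitoneOn g (Ici 0) := by
    refine antitoneOn_of_hasDerivWithinAt_nonpos (f' := g') (convex_Ici 0)
      (fun t ht => (hg t ht).continuousAt.continuousWithinAt) (fun t ht => ?_) (fun t ht => ?_)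
    · exact (hg t (interior_subset ht)).hasDerivWithinAt
    · have ht := interior_subset ht
      have := Real.rpow_nonneg (hg0 t ht) (p + 1)
      nlinarith [hg' t ht]
  rcases (hg0 0 le_rfl).eq_or_lt with h0 | h0
  · refine ⟨1, one_pos, fun t ht => ?_⟩
    have : g t ≤ 0 := h0 ▸ hanti self_mem_Ici ht ht
    exact this.trans (by positivity)
  refine ⟨g 0 ^ (-p) / (p * c), by positivity, fun T hT => ?_⟩
  rcases (hg0 T hT).eq_or_lt with hT0 | hT0
  · rw [← hT0]
    positivity
  have hpos : ∀ t ∈ Icc 0 T, 0 < g t := fun t ht => hT0.trans_le (hanti ht.1 hT ht.2)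
  have hder : ∀ t ∈ Icc 0 T, HasDerivAt (fun s => g s ^ (-p) - p * c * s)
      (g' t * (-p) * g t ^ (-p - 1) - p * c * 1) t := fun t ht =>
    ((hg t ht.1).rpow_const (Or.inl (hpos t ht).ne')).sub ((hasDerivAt_id t).const_mul _)
  have hmono : MonotoneOn (fun s => g s ^ (-p) - p * c * s) (Icc 0 T) := by
    refine monotoneOn_of_hasDerivWithinAt_nonneg (convex_Icc 0 T)
      (fun t ht => (hder t ht).continuousAt.continuousWithinAt)
      (fun t ht => (hder t (interior_subset ht)).hasDerivWithinAt) (fun t ht => ?_)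
    have ht := interior_subset ht
    have hmul : g t ^ (p + 1) * g t ^ (-p - 1) = 1 := by
      rw [← Real.rpow_add (hpos t ht)]
      simp
    have hle := mul_le_mul_of_nonneg_right (hg' t ht.1)
      (mul_nonneg hp.le (Real.rpow_nonneg (hpos t ht).le (-p - 1)))
    linear_combination hle - p * c * hmul
  have hT' := hmono (left_mem_Icc.2 hT) (right_mem_Icc.2 hT) hT
  have hle : p * c * (T + g 0 ^ (-p) / (p * c)) ≤ g T ^ (-p) := by
    rw [mul_add, mul_div_cancel₀ _ (by positivity)]
    simp only [mul_zero, sub_zero] at hT'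
    linarith
  calc g T = (g T ^ (-p)) ^ (-(1 / p)) := by
        rw [← Real.rpow_mul hT0.le, neg_mul_neg, mul_one_div_cancel hp.ne', Real.rpow_one]
    _ ≤ _ := Real.rpow_le_rpow_of_nonpos (by positivity) hle
        (neg_nonpos.2 (by positivity))

/-- If the Łojasiewicz inequalities hold with exponent `θ > 1/2` on a neighbourhood `V`
of `x*`, then a gradient flow of `f` remaining in `V` converges to
`Z = {x ∈ U : f(x) = f(x*)}` as a power law: setting `α = (1−θ)/(2θ−1) > 0`,
`d(x(t), Z) ≤ A·(t + B)^{−α}` for all `t ≥ 0`, for some constants `A > 0` and `B`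
with `t + B > 0` for all `t ≥ 0`. -/
theorem gradient_flow_power_law_convergence {d : ℕ}
    (U : Set (EuclideanSpace ℝ (Fin d))) (hU : IsOpen U)
    (f : EuclideanSpace ℝ (Fin d) → ℝ) (hf : ContDiffOn ℝ 1 f U)
    (xstar : EuclideanSpace ℝ (Fin d)) (hxstar : xstar ∈ U)
    (hmin : ∀ x ∈ U, f xstar ≤ f x)
    (θ C C' : ℝ) (hθ : θ ∈ Set.Ico (1 / 2 : ℝ) 1) (hC : 0 < C) (hC' : 0 < C')
    (V : Set (EuclideanSpace ℝ (Fin d))) (hV : IsOpen V) (hxV : xstar ∈ V) (hVU : V ⊆ U)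
    (hloj₁ : ∀ x ∈ V, C * |f x - f xstar| ^ θ ≤ ‖gradient f x‖)
    (hloj₂ : ∀ x ∈ V,
      C' * (infDist x {y ∈ U | f y = f xstar}) ^ (1 / (1 - θ)) ≤ |f x - f xstar|)
    (x : ℝ → EuclideanSpace ℝ (Fin d))
    (hflow : ∀ t ≥ (0 : ℝ), HasDerivAt x (-(gradient f (x t))) t)
    (hxinV : ∀ t ≥ (0 : ℝ), x t ∈ V)
    (hθgt : 1 / 2 < θ) :
    0 < (1 - θ) / (2 * θ - 1) ∧
    ∃ A > (0 : ℝ), ∃ B : ℝ, (∀ t ≥ (0 : ℝ), 0 < t + B) ∧ ∀ t ≥ (0 : ℝ),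
      infDist (x t) {y ∈ U | f y = f xstar} ≤
        A * (t + B) ^ (-((1 - θ) / (2 * θ - 1))) := by
  obtain ⟨-, hθ1⟩ := hθ
  have hp : 0 < 2 * θ - 1 := by linarith
  have hq : 0 < 1 - θ := by linarith
  refine ⟨div_pos hq hp, ?_⟩
  have hnonneg : ∀ t ≥ (0 : ℝ), 0 ≤ f (x t) - f xstar := fun t ht =>
    sub_nonneg.2 (hmin _ (hVU (hxinV t ht)))
  have hderiv : ∀ t ≥ (0 : ℝ), HasDerivAt (fun s => f (x s) - f xstar)
      (-‖gradient f (x t)‖ ^ 2) t := fun t ht =>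
    (HasDerivAt.comp_gradient_flow ((hf.differentiableOn one_ne_zero).differentiableAt
      (hU.mem_nhds (hVU (hxinV t ht)))) (hflow t ht)).sub_const _
  obtain ⟨B, hB, hdecay⟩ := exists_le_rpow_of_deriv_le_neg_rpow hp (pow_pos hC 2) hderiv hnonneg
    (fun t ht => by
      have h := hloj₁ _ (hxinV t ht)
      rw [abs_of_nonneg (hnonneg t ht)] at h
      have h2 := pow_le_pow_left₀ (mul_nonneg hC.le (Real.rpow_nonneg (hnonneg t ht) θ)) h 2
      rw [mul_pow, ← Real.rpow_mul_natCast (hnonneg t ht)] at h2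
      rw [sub_add_cancel, mul_comm 2 θ]
      exact neg_le_neg h2)
  refine ⟨(C'⁻¹ * ((2 * θ - 1) * C ^ 2) ^ (-(1 / (2 * θ - 1)))) ^ (1 - θ), by positivity, B,
    fun t ht => by positivity, fun t ht => ?_⟩
  have htB : 0 < t + B := by positivity
  have h := hloj₂ _ (hxinV t ht)
  rw [abs_of_nonneg (hnonneg t ht)] at h
  set D := infDist (x t) {y ∈ U | f y = f xstar}
  have hD : 0 ≤ D := infDist_nonneg
  have hle : D ^ (1 / (1 - θ)) ≤
      C'⁻¹ * ((2 * θ - 1) * C ^ 2) ^ (-(1 / (2 * θ - 1))) * (t + B) ^ (-(1 / (2 * θ - 1))) := by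
    rw [mul_assoc, ← Real.mul_rpow (by positivity) htB.le, le_inv_mul_iff₀ hC']
    exact h.trans (hdecay t ht)
  calc D = (D ^ (1 / (1 - θ))) ^ (1 - θ) := by
        rw [← Real.rpow_mul hD, one_div_mul_cancel hq.ne', Real.rpow_one]
    _ ≤ _ := Real.rpow_le_rpow (by positivity) hle hq.le
    _ = _ := by
        rw [Real.mul_rpow (by positivity) (by positivity), ← Real.rpow_mul htB.le]
        congr 2
        ring
end

section
/- Let r > 0 and let x : ℝ → ℝ be differentiable on [0,∞) with x'(t) = −r·x(t) − x(t)³ for all t ≥ 0. Then |x(t)| ≤ |x(0)|·e^{−r·t} for all t ≥ 0. -/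
/-- Exponential convergence of the gradient flow `x'(t) = −r·x(t) − x(t)³` of the
non-degenerate potential `f_r(x) = (r/2)·x² + (1/4)·x⁴` with `r > 0`:
`|x(t)| ≤ |x(0)|·e^{−r·t}` for all `t ≥ 0`. -/
theorem pitchfork_gradient_flow_exponential
    (r : ℝ) (hr : 0 < r) (x : ℝ → ℝ)
    (hder : ∀ t ≥ (0 : ℝ), HasDerivAt x (-(r * x t) - (x t) ^ 3) t) :
    ∀ t ≥ (0 : ℝ), |x t| ≤ |x 0| * Real.exp (-r * t) := by
  have hg : ∀ t ≥ (0 : ℝ), HasDerivAt (fun s => (x s * Real.exp (r * s)) ^ 2)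
      (-(2 * (x t ^ 2 * Real.exp (r * t)) ^ 2)) t := by
    intro t ht
    have he : HasDerivAt (fun s => Real.exp (r * s)) (Real.exp (r * t) * r) t := by
      simpa using ((hasDerivAt_id t).const_mul r).exp
    refine (((hder t ht).fun_mul he).fun_pow 2).congr_deriv ?_
    push_cast
    ring
  have hanti : AntitoneOn (fun s => (x s * Real.exp (r * s)) ^ 2) (Set.Ici 0) := by
    refine antitoneOn_of_deriv_nonpos (convex_Ici 0)
      (fun t ht => (hg t ht).continuousAt.continuousWithinAt)
      (fun t ht => (hg t (interior_subset ht)).differentiableAt.differentiableWithinAt)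
      fun t ht => ?_
    rw [(hg t (interior_subset ht)).deriv]
    exact neg_nonpos.mpr (by positivity)
  intro t ht
  have hle : |x t * Real.exp (r * t)| ≤ |x 0| := by
    simpa using sq_le_sq.mp (hanti Set.self_mem_Ici ht ht)
  rw [abs_mul, Real.abs_exp] at hle
  rwa [neg_mul, Real.exp_neg, ← div_eq_mul_inv, le_div_iff₀ (Real.exp_pos _)]
end

section
/- For every β with 0 < β ≤ 1 and every m ∈ ℝ, tanh(β·m) = m if and only if m = 0. -/
theorem Real.sinh_lt_self_mul_cosh {x : ℝ} (hx : 0 < x) : Real.sinh x < x * Real.cosh x := by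
  have hderiv (y : ℝ) :
      HasDerivAt (fun y => y * Real.cosh y - Real.sinh y) (y * Real.sinh y) y := by
    refine (((hasDerivAt_id' y).mul (Real.hasDerivAt_cosh y)).sub
      (Real.hasDerivAt_sinh y)).congr_deriv ?_
    ring
  have hmono : StrictMonoOn (fun y => y * Real.cosh y - Real.sinh y) (Set.Ici (0 : ℝ)) := by
    refine strictMonoOn_of_deriv_pos (convex_Ici 0)
      (fun y _ => (hderiv y).continuousAt.continuousWithinAt) fun y hy => ?_
    rw [interior_Ici, Set.mem_Ioi] at hy
    rw [(hderiv y).deriv]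
    exact mul_pos hy (Real.sinh_pos_iff.2 hy)
  simpa using hmono Set.self_mem_Ici hx.le hx

theorem Real.tanh_lt_self {x : ℝ} (hx : 0 < x) : Real.tanh x < x := by
  rw [Real.tanh_eq_sinh_div_cosh, div_lt_iff₀ (Real.cosh_pos x)]
  exact Real.sinh_lt_self_mul_cosh hx

/-- In the high-temperature regime `0 < β ≤ 1`, the mean-field self-consistency
equation `tanh(β·m) = m` has only the trivial solution `m = 0`. -/
theorem ising_self_consistency_high_temperature
    (β : ℝ) (hβ₀ : 0 < β) (hβ₁ : β ≤ 1) :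
    ∀ m : ℝ, Real.tanh (β * m) = m ↔ m = 0 := by
  have hlt {m : ℝ} (hm : 0 < m) : Real.tanh (β * m) < m :=
    (Real.tanh_lt_self (mul_pos hβ₀ hm)).trans_le (mul_le_of_le_one_left hm.le hβ₁)
  refine fun m => ⟨fun h => ?_, fun h => by simp [h]⟩
  rcases lt_trichotomy m 0 with hm | hm | hm
  · have := hlt (neg_pos.2 hm)
    rw [mul_neg, Real.tanh_neg, h] at this
    exact absurd this (lt_irrefl _)
  · exact hm
  · exact absurd h (hlt hm).ne
end

section
/- For every β > 1 there exists M ∈ (0, 1) with tanh(β·M) = M, and the full solution set is {m ∈ ℝ : tanh(β·m) = m} = {−M, 0, M}; in particular the equation has exactly three solutions. -/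
theorem Real.hasDerivAt_tanh (x : ℝ) : HasDerivAt Real.tanh (1 - Real.tanh x ^ 2) x := by
  have h := (Real.hasDerivAt_sinh x).div (Real.hasDerivAt_cosh x) (Real.cosh_pos x).ne'
  have hfun : Real.sinh / Real.cosh = Real.tanh :=
    funext fun y => (Real.tanh_eq_sinh_div_cosh y).symm
  rw [hfun] at h
  refine h.congr_deriv ?_
  have hc := (Real.cosh_pos x).ne'
  rw [Real.tanh_eq_sinh_div_cosh]
  field_simp

theorem Real.continuous_tanh : Continuous Real.tanh :=
  continuous_iff_continuousAt.2 fun x => (Real.hasDerivAt_tanh x).continuousAt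

theorem Real.strictMono_tanh : StrictMono Real.tanh :=
  strictMono_of_deriv_pos fun x => by
    rw [(Real.hasDerivAt_tanh x).deriv]
    linarith [Real.tanh_sq_lt_one x]

theorem Real.strictConcaveOn_tanh_Ici : StrictConcaveOn ℝ (Set.Ici 0) Real.tanh := by
  refine StrictAntiOn.strictConcaveOn_of_deriv (convex_Ici 0)
    Real.continuous_tanh.continuousOn ?_
  rw [interior_Ici]
  intro x hx y _ hxy
  rw [(Real.hasDerivAt_tanh x).deriv, (Real.hasDerivAt_tanh y).deriv]
  have hx0 : 0 < Real.tanh x := by simpa using Real.strictMono_tanh hx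
  nlinarith [Real.strictMono_tanh hxy]

/-- `tanh x / x` is strictly decreasing on the positive half-line. -/
theorem Real.strictAntiOn_tanh_div_self :
    StrictAntiOn (fun x => Real.tanh x / x) (Set.Ioi 0) := by
  intro x hx y hy hxy
  have hx' : (0 : ℝ) < x := hx
  have hy' : (0 : ℝ) < y := hy
  simpa using Real.strictConcaveOn_tanh_Ici.secant_strict_mono (a := 0) Set.self_mem_Ici
    hx'.le hy'.le hx'.ne' hy'.ne' hxy

theorem eq_of_tanh_mul_eq_self {β m n : ℝ} (hβ : 0 < β) (hm : 0 < m) (hn : 0 < n)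
    (hm' : Real.tanh (β * m) = m) (hn' : Real.tanh (β * n) = n) : m = n := by
  have h : β * m = β * n := by
    refine Real.strictAntiOn_tanh_div_self.injOn (mul_pos hβ hm) (mul_pos hβ hn) ?_
    simp only [hm', hn']
    field_simp
  exact mul_left_cancel₀ hβ.ne' h

theorem exists_tanh_mul_eq_self {β : ℝ} (hβ : 1 < β) :
    ∃ M ∈ Set.Ioo (0 : ℝ) 1, Real.tanh (β * M) = M := by
  have hd : HasDerivAt (fun m => Real.tanh (β * m)) β 0 := by
    have h := (Real.hasDerivAt_tanh (β * 0)).comp 0 ((hasDerivAt_id (0 : ℝ)).const_mul β)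
    simpa [Function.comp_def] using h
  obtain ⟨ε, hε, hε1, hε0⟩ := ((hd.tendsto_slope_zero_right.eventually_const_lt hβ).and
    (Ioo_mem_nhdsGT (zero_lt_one' ℝ))).exists
  have hlt : ε < Real.tanh (β * ε) := by
    have h : 1 < ε⁻¹ * Real.tanh (β * ε) := by simpa using hε
    rwa [lt_inv_mul_iff₀ hε1, mul_one] at h
  have hc : ContinuousOn (fun m => Real.tanh (β * m) - m) (Set.Icc ε 1) :=
    ((Real.continuous_tanh.comp (continuous_const_mul β)).sub continuous_id).continuousOn
  obtain ⟨M, hM, hM0⟩ := intermediate_value_Ioo' hε0.le hc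
    (show (0 : ℝ) ∈ Set.Ioo _ _ from ⟨sub_neg.2 (Real.tanh_lt_one _), sub_pos.2 hlt⟩)
  exact ⟨M, ⟨hε1.trans hM.1, hM.2⟩, sub_eq_zero.1 hM0⟩

/-- In the low-temperature regime `β > 1`, the mean-field self-consistency equation
`tanh(β·m) = m` has a solution `M ∈ (0, 1)`, and the full solution set is exactly
`{−M, 0, M}`; in particular the equation has exactly three solutions. -/
theorem ising_self_consistency_low_temperature
    (β : ℝ) (hβ : 1 < β) :
    ∃ M ∈ Set.Ioo (0 : ℝ) 1,
      Real.tanh (β * M) = M ∧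
      {m : ℝ | Real.tanh (β * m) = m} = {-M, 0, M} ∧
      ({-M, 0, M} : Set ℝ).ncard = 3 := by
  obtain ⟨M, ⟨hM0, hM1⟩, hM⟩ := exists_tanh_mul_eq_self hβ
  have hβ0 : 0 < β := zero_lt_one.trans hβ
  refine ⟨M, ⟨hM0, hM1⟩, hM, ?_, ?_⟩
  · ext m
    simp only [Set.mem_ofPred_eq, Set.mem_insert_iff, Set.mem_singleton_iff]
    constructor
    · intro hm
      rcases lt_trichotomy m 0 with h | h | h
      · left
        have hneg : Real.tanh (β * -m) = -m := by rw [mul_neg, Real.tanh_neg, hm]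
        exact neg_eq_iff_eq_neg.1
          (eq_of_tanh_mul_eq_self hβ0 (neg_pos.2 h) hM0 hneg hM)
      · exact Or.inr (Or.inl h)
      · exact Or.inr (Or.inr (eq_of_tanh_mul_eq_self hβ0 h hM0 hm hM))
    · rintro (rfl | rfl | rfl)
      · rw [mul_neg, Real.tanh_neg, hM]
      · simp
      · exact hM
  · exact Set.ncard_eq_three.2
      ⟨-M, 0, M, by linarith, by linarith, by linarith, rfl⟩
end
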